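/- arXiv:1808.08486 — 4 statements merged into one kernel-verified Lean document; each statement's English description precedes it below -/
import Mathlib

section
/- If J is a sequence of length 4n - 3 in (ℤ/nℤ)², then J contains a zero-sum subsequence of length n. -/
open Finset in
theorem kz_signed {F : Type*} [Field F] (J : Finset ℕ) (P : MvPolynomial ℕ F)
    (h : P.totalDegree < #J) :
    ∑ I ∈ J.powerset, (-1 : F) ^ #I * MvPolynomial.eval (fun i => if i ∈ I then (1 : F) else 0) P = 0 := by
  classical
  simp_rw [MvPolynomial.eval_eq, Finset.mul_sum]
  rw [Finset.sum_comm]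
  refine Finset.sum_eq_zero fun d hd => ?_
  have h1 : #d.support < #J := by
    refine lt_of_le_of_lt ?_ h
    refine le_trans ?_ (MvPolynomial.le_totalDegree hd)
    rw [Finsupp.sum, Finset.card_eq_sum_ones]
    refine Finset.sum_le_sum fun i hi => ?_
    have := Finsupp.mem_support_iff.1 hi
    omega
  obtain ⟨i, hiJ, hid⟩ := Finset.exists_mem_notMem_of_card_lt_card h1
  rw [← Finset.insert_erase hiJ, Finset.sum_powerset_insert (Finset.notMem_erase i J),
    ← Finset.sum_add_distrib]
  refine Finset.sum_eq_zero fun I hI => ?_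
  have hiI : i ∉ I := fun hh => Finset.notMem_erase i J (Finset.mem_powerset.1 hI hh)
  rw [Finset.card_insert_of_notMem hiI]
  have : ∏ j ∈ d.support, (if j ∈ insert i I then (1 : F) else 0) ^ d j
      = ∏ j ∈ d.support, (if j ∈ I then (1 : F) else 0) ^ d j := by
    refine Finset.prod_congr rfl fun j hj => ?_
    have : j ≠ i := fun e => hid (e ▸ hj)
    simp [this]
  rw [this]; ring

/-- number of zero-sum `k`-subsets -/
def kzN {A : Type*} [AddCommMonoid A] [DecidableEq A] (f : ℕ → A) (J : Finset ℕ) (k : ℕ) : ℕ :=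
  ((J.powersetCard k).filter (fun I => ∑ i ∈ I, f i = 0)).card

open Finset in
theorem kz_zero {p : ℕ} [Fact p.Prime] (f : ℕ → ZMod p × ZMod p) (J : Finset ℕ)
    (h : 3 * p - 2 ≤ #J) :
    ∑ I ∈ J.powerset, (-1 : ZMod p) ^ #I *
      (if p ∣ #I ∧ ∑ i ∈ I, f i = 0 then 1 else 0) = 0 := by
  classical
  have hp := (Fact.out : p.Prime).two_le
  let L : (ℕ → ZMod p) → MvPolynomial ℕ (ZMod p) := fun a =>
    1 - (∑ i ∈ J, MvPolynomial.C (a i) * MvPolynomial.X i) ^ (p - 1)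
  have hL : ∀ a, (L a).totalDegree ≤ p - 1 := by
    intro a
    refine (MvPolynomial.totalDegree_sub _ _).trans (max_le (by simp) ?_)
    refine (MvPolynomial.totalDegree_pow _ _).trans ?_
    refine (Nat.mul_le_mul_left _ (?_ : _ ≤ 1)).trans (by simp)
    refine MvPolynomial.totalDegree_finsetSum_le fun i _ => ?_
    refine (MvPolynomial.totalDegree_mul _ _).trans ?_
    simp
  have hev : ∀ a, ∀ I ∈ J.powerset,
      MvPolynomial.eval (fun i => if i ∈ I then (1 : ZMod p) else 0) (L a) =
        if ∑ i ∈ I, a i = 0 then 1 else 0 := by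
    intro a I hI
    have hs : ∑ i ∈ J, a i * (if i ∈ I then (1 : ZMod p) else 0) = ∑ i ∈ I, a i := by
      simp only [mul_ite, mul_one, mul_zero]
      rw [← Finset.sum_filter, Finset.filter_mem_eq_inter,
        Finset.inter_eq_right.2 (Finset.mem_powerset.1 hI)]
    simp only [L, map_sub, map_one, map_pow, map_sum, map_mul, MvPolynomial.eval_C,
      MvPolynomial.eval_X, hs]
    split_ifs with h0
    · rw [h0, zero_pow (by omega)]; simp
    · rw [ZMod.pow_card_sub_one_eq_one h0]; simp
  have key := kz_signed J (L (fun _ => 1) * L (fun i => (f i).1) * L (fun i => (f i).2)) (by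
    have h1 := MvPolynomial.totalDegree_mul (L (fun _ => 1) * L (fun i => (f i).1)) (L (fun i => (f i).2))
    have h2 := MvPolynomial.totalDegree_mul (L (fun _ => 1)) (L (fun i => (f i).1))
    have := hL (fun _ => 1)
    have := hL (fun i => (f i).1)
    have := hL (fun i => (f i).2)
    omega)
  refine Eq.trans ?_ key
  refine Finset.sum_congr rfl fun I hI => ?_
  rw [map_mul, map_mul, hev _ I hI, hev _ I hI, hev _ I hI]
  have e1 : (∑ i ∈ I, (1 : ZMod p) = 0) ↔ p ∣ #I := by
    simp [ZMod.natCast_eq_zero_iff]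
  have e2 : (∑ i ∈ I, f i = 0) ↔ (∑ i ∈ I, (f i).1 = 0) ∧ (∑ i ∈ I, (f i).2 = 0) := by
    rw [Prod.ext_iff, Prod.fst_sum, Prod.snd_sum]; rfl
  simp only [e1, e2]
  by_cases c1 : p ∣ #I <;> by_cases c2 : ∑ i ∈ I, (f i).1 = 0 <;>
    by_cases c3 : ∑ i ∈ I, (f i).2 = 0 <;> simp [c1, c2, c3]

open Finset in
theorem kzN_big {A : Type*} [AddCommMonoid A] [DecidableEq A] (f : ℕ → A) (J : Finset ℕ) (k : ℕ)
    (h : #J < k) : kzN f J k = 0 := by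
  simp [kzN, Finset.powersetCard_eq_empty.2 h]

theorem kzN_zero {A : Type*} [AddCommMonoid A] [DecidableEq A] (f : ℕ → A) (J : Finset ℕ) :
    kzN f J 0 = 1 := by
  simp [kzN, Finset.filter_singleton]

open Finset in
theorem kz_E1 {p : ℕ} [Fact p.Prime] (hodd : Odd p) (f : ℕ → ZMod p × ZMod p) (J : Finset ℕ)
    (h : 3 * p - 2 ≤ #J) (h' : #J < 4 * p) :
    (1 : ZMod p) - kzN f J p + kzN f J (2 * p) - kzN f J (3 * p) = 0 := by
  classical
  have hp := (Fact.out : p.Prime).two_le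
  have key := kz_zero f J h
  rw [Finset.sum_powerset] at key
  have e : ∀ k, ∑ I ∈ J.powersetCard k, (-1 : ZMod p) ^ #I *
      (if p ∣ #I ∧ ∑ i ∈ I, f i = 0 then 1 else 0) = if p ∣ k then (-1) ^ k * (kzN f J k : ZMod p) else 0 := by
    intro k
    have : ∀ I ∈ J.powersetCard k, (-1 : ZMod p) ^ #I *
      (if p ∣ #I ∧ ∑ i ∈ I, f i = 0 then 1 else 0) =
      if p ∣ k then (-1) ^ k * (if ∑ i ∈ I, f i = 0 then 1 else 0) else 0 := by
      intro I hI
      rw [(Finset.mem_powersetCard.1 hI).2]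
      split_ifs <;> simp_all
    rw [Finset.sum_congr rfl this]
    split_ifs
    · rw [← Finset.mul_sum, Finset.sum_boole]; rfl
    · simp
  simp_rw [e] at key
  have e3 : ∑ k ∈ range (4 * p), (if p ∣ k then (-1) ^ k * (kzN f J k : ZMod p) else 0) = 0 := by
    refine Eq.trans ?_ key
    symm
    refine Finset.sum_subset (Finset.range_subset_range.2 (by omega)) fun k _ hk => ?_
    rw [kzN_big f J k (by simp at hk; omega)]
    simp
  have e4 : ∑ k ∈ range 4, (-1 : ZMod p) ^ (k * p) * (kzN f J (k * p) : ZMod p) = 0 := by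
    refine Eq.trans ?_ e3
    rw [← Finset.sum_filter]
    refine Finset.sum_bij (fun k _ => k * p) ?_ ?_ ?_ ?_
    · intro k hk
      simp only [Finset.mem_filter, Finset.mem_range] at hk ⊢
      exact ⟨by nlinarith, Dvd.intro_left k rfl⟩
    · intro a _ b _ hab
      exact Nat.eq_of_mul_eq_mul_right (by omega) hab
    · intro b hb
      simp only [Finset.mem_filter, Finset.mem_range] at hb
      obtain ⟨hb, c, rfl⟩ := hb
      refine ⟨c, ?_, by ring⟩
      simp
      by_contra hc
      have : 4 ≤ c := by omega
      nlinarith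
    · intros; rfl
  have o : (-1 : ZMod p) ^ p = -1 := hodd.neg_one_pow
  simp only [Finset.sum_range_succ, Finset.sum_range_zero, Nat.mul_comm _ p, pow_mul, o] at e4
  rw [mul_zero, kzN_zero] at e4
  simp only [mul_one] at e4
  rw [← e4, mul_comm 2 p, mul_comm 3 p]
  push_cast; ring

open Finset in
theorem kzN_insert {A : Type*} [AddCommMonoid A] [DecidableEq A] (f : ℕ → A) (J : Finset ℕ) (y k : ℕ)
    (hy : y ∉ J) : kzN (Function.update f y 0) (insert y J) (k + 1) = kzN f J (k + 1) + kzN f J k := by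
  classical
  have hs : ∀ I : Finset ℕ, I ⊆ J → ∑ i ∈ I, Function.update f y 0 i = ∑ i ∈ I, f i := by
    intro I hI
    refine Finset.sum_congr rfl fun i hi => ?_
    rw [Function.update_of_ne]
    rintro rfl
    exact hy (hI hi)
  have hs' : ∀ I : Finset ℕ, I ⊆ J → ∑ i ∈ insert y I, Function.update f y 0 i = ∑ i ∈ I, f i := by
    intro I hI
    rw [Finset.sum_insert (fun h => hy (hI h)), hs I hI]; simp
  unfold kzN
  simp only [Finset.card_filter]
  rw [Finset.powersetCard_succ_insert hy, Finset.sum_union, Finset.sum_image]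
  · congr 1
    · exact Finset.sum_congr rfl fun I hI => by rw [hs I (Finset.mem_powersetCard.1 hI).1]
    · exact Finset.sum_congr rfl fun I hI => by rw [hs' I (Finset.mem_powersetCard.1 hI).1]
  · intro a ha b hb hab
    have ha' : y ∉ a := fun h => hy ((Finset.mem_powersetCard.1 ha).1 h)
    have hb' : y ∉ b := fun h => hy ((Finset.mem_powersetCard.1 hb).1 h)
    rw [← Finset.erase_insert ha', ← Finset.erase_insert hb']
    rw [hab]
  · rw [Finset.disjoint_left]
    intro a ha hb
    obtain ⟨b, _, rfl⟩ := Finset.mem_image.1 hb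
    exact hy ((Finset.mem_powersetCard.1 ha).1 (Finset.mem_insert_self _ _))

open Finset in
theorem kz_E2 {p : ℕ} [Fact p.Prime] (hodd : Odd p) (f : ℕ → ZMod p × ZMod p) (J : Finset ℕ)
    (h : 3 * p - 3 ≤ #J) (h' : #J + 1 < 4 * p) :
    (1 : ZMod p) - kzN f J p - kzN f J (p - 1) + kzN f J (2 * p) + kzN f J (2 * p - 1)
      - kzN f J (3 * p) - kzN f J (3 * p - 1) = 0 := by
  classical
  have hp := (Fact.out : p.Prime).two_le
  obtain ⟨y, hy⟩ := Infinite.exists_notMem_finset J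
  have c := Finset.card_insert_of_notMem hy
  have := kz_E1 hodd (Function.update f y 0) (insert y J) (by omega) (by omega)
  have e1 := kzN_insert f J y (p - 1) hy
  have e2 := kzN_insert f J y (2 * p - 1) hy
  have e3 := kzN_insert f J y (3 * p - 1) hy
  rw [Nat.sub_add_cancel (by omega)] at e1 e2 e3
  rw [e1, e2, e3] at this
  push_cast at this
  linear_combination this

open Finset in
theorem kz_count {A : Type*} [AddCommMonoid A] [DecidableEq A] (f : ℕ → A) (J : Finset ℕ) (m k : ℕ) :
    ∑ D ∈ J.powersetCard m, kzN f (J \ D) k = (#J - k).choose m * kzN f J k := by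
  classical
  have : ∀ D, kzN f (J \ D) k = ∑ I ∈ ((J \ D).powersetCard k).filter (fun I => ∑ i ∈ I, f i = 0), 1 := by
    intro D; simp [kzN]
  simp_rw [this]
  rw [Finset.sum_comm' (t' := (J.powersetCard k).filter (fun I => ∑ i ∈ I, f i = 0))
    (s' := fun I => (J \ I).powersetCard m)]
  · have : ∀ I ∈ (J.powersetCard k).filter (fun I => ∑ i ∈ I, f i = 0),
      ∑ D ∈ (J \ I).powersetCard m, 1 = (#J - k).choose m := by
      intro I hI
      simp only [Finset.mem_filter, Finset.mem_powersetCard] at hI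
      rw [Finset.sum_const, Finset.card_powersetCard, Finset.card_sdiff_of_subset hI.1.1, hI.1.2]
      simp
    rw [Finset.sum_congr rfl this, Finset.sum_const, smul_eq_mul, mul_comm]; rfl
  · intro D I
    simp only [Finset.mem_filter, Finset.mem_powersetCard, Finset.subset_sdiff]
    have := @disjoint_comm _ _ _ D I
    tauto

open Finset in
theorem kz_count2 {A : Type*} [AddCommGroup A] [DecidableEq A] (f : ℕ → A) (J : Finset ℕ) (a c : ℕ) :
    ∑ I ∈ (J.powersetCard a).filter (fun I => ∑ i ∈ I, f i = 0), kzN f (J \ I) c =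
    ∑ E ∈ (J.powersetCard (a + c)).filter (fun I => ∑ i ∈ I, f i = 0), kzN f E c := by
  classical
  unfold kzN
  rw [← Finset.card_sigma, ← Finset.card_sigma]
  refine Finset.card_bij' (fun x _ => ⟨x.1 ∪ x.2, x.2⟩) (fun x _ => ⟨x.1 \ x.2, x.2⟩) ?_ ?_ ?_ ?_
  · rintro ⟨x, y⟩ h
    simp only [Finset.mem_sigma, Finset.mem_filter, Finset.mem_powersetCard, Finset.subset_sdiff] at h ⊢
    obtain ⟨⟨⟨h1, h2⟩, h3⟩, ⟨⟨h4, h5⟩, h6⟩, h7⟩ := h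
    refine ⟨⟨⟨Finset.union_subset h1 h4, ?_⟩, ?_⟩, ⟨Finset.subset_union_right, h6⟩, h7⟩
    · rw [Finset.card_union_of_disjoint h5.symm, h2, h6]
    · rw [Finset.sum_union h5.symm, h3, h7, add_zero]
  · rintro ⟨x, y⟩ h
    simp only [Finset.mem_sigma, Finset.mem_filter, Finset.mem_powersetCard, Finset.subset_sdiff] at h ⊢
    obtain ⟨⟨⟨h1, h2⟩, h3⟩, ⟨h4, h6⟩, h7⟩ := h
    refine ⟨⟨⟨Finset.sdiff_subset.trans h1, ?_⟩, ?_⟩, ⟨⟨h4.trans h1, Finset.disjoint_sdiff⟩, h6⟩, h7⟩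
    · rw [Finset.card_sdiff_of_subset h4]; omega
    · rw [Finset.sum_sdiff_eq_sub h4, h3, h7, sub_zero]
  · rintro ⟨x, y⟩ h
    simp only [Finset.mem_sigma, Finset.mem_filter, Finset.mem_powersetCard, Finset.subset_sdiff] at h ⊢
    simp only [Finset.union_sdiff_cancel_right h.2.1.1.2.symm]
  · rintro ⟨x, y⟩ h
    simp only [Finset.mem_sigma, Finset.mem_filter, Finset.mem_powersetCard, Finset.subset_sdiff] at h ⊢
    simp only [Finset.sdiff_union_of_subset h.2.1.1]

open Finset in
theorem kzN_ne {A : Type*} [AddCommMonoid A] [DecidableEq A] {f : ℕ → A} {J : Finset ℕ} {k : ℕ}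
    (h : kzN f J k ≠ 0) : ∃ I ⊆ J, #I = k ∧ ∑ i ∈ I, f i = 0 := by
  unfold kzN at h
  obtain ⟨I, hI⟩ := Finset.card_ne_zero.1 h
  simp only [Finset.mem_filter, Finset.mem_powersetCard] at hI
  exact ⟨I, hI.1.1, hI.1.2, hI.2⟩

open Finset in
theorem kzN_eq_zero {A : Type*} [AddCommMonoid A] [DecidableEq A] {f : ℕ → A} {J : Finset ℕ} {k : ℕ}
    (h : ¬ ∃ I ⊆ J, #I = k ∧ ∑ i ∈ I, f i = 0) : kzN f J k = 0 := by
  by_contra h'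
  exact h (kzN_ne h')

theorem kz_choose {p : ℕ} [Fact p.Prime] (q r : ℕ) (hr : r < p) :
    ((q * p + r).choose p : ZMod p) = q := by
  have hp := (Fact.out : p.Prime).two_le
  have := Choose.choose_modEq_choose_mod_mul_choose_div_nat (n := q * p + r) (k := p) (p := p)
  rw [← ZMod.natCast_eq_natCast_iff] at this
  rw [this, Nat.mod_self, Nat.div_self (by omega)]
  rw [show (q * p + r) / p = q by
    rw [mul_comm, Nat.mul_add_div (by omega), Nat.div_eq_of_lt hr, add_zero]]
  simp

open Finset in
theorem kz_odd {p : ℕ} [Fact p.Prime] (hodd : Odd p) (f : ℕ → ZMod p × ZMod p) (J : Finset ℕ)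
    (hJ : #J = 4 * p - 3) : ∃ I ⊆ J, #I = p ∧ ∑ i ∈ I, f i = 0 := by
  classical
  by_contra hno
  have hp2 := (Fact.out : p.Prime).two_le
  have hp : 3 ≤ p := by
    obtain ⟨k, hk⟩ := hodd; omega
  have hsub : ∀ K ⊆ J, kzN f K p = 0 := fun K hK => kzN_eq_zero (by
    rintro ⟨I, h1, h2⟩
    exact hno ⟨I, h1.trans hK, h2⟩)
  have hE1 : ∀ K ⊆ J, 3 * p - 2 ≤ #K → #K < 3 * p → (kzN f K (2 * p) : ZMod p) = -1 := by
    intro K hK h1 h2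
    have := kz_E1 hodd f K h1 (by omega)
    rw [hsub K hK, kzN_big f K (3 * p) h2] at this
    push_cast at this
    linear_combination this
  -- Alon-Dubiner
  have h3p : kzN f J (3 * p) = 0 := by
    apply kzN_eq_zero
    rintro ⟨I, hIJ, hc, hs⟩
    obtain ⟨x, hx⟩ : I.Nonempty := Finset.card_pos.1 (by omega)
    have c := Finset.card_erase_of_mem hx
    have h1 := hE1 (I.erase x) ((Finset.erase_subset _ _).trans hIJ) (by omega) (by omega)
    have h2 : kzN f (I.erase x) (2 * p) ≠ 0 := by
      intro h0
      rw [h0] at h1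
      simp at h1
    obtain ⟨C, hC, hCc, hCs⟩ := kzN_ne h2
    have hCI := hC.trans (Finset.erase_subset _ _)
    refine hno ⟨I \ C, Finset.sdiff_subset.trans hIJ, ?_, ?_⟩
    · rw [Finset.card_sdiff_of_subset hCI]; omega
    · rw [Finset.sum_sdiff_eq_sub hCI, hs, hCs, sub_zero]
  have hA : (kzN f J (p - 1) : ZMod p) = kzN f J (3 * p - 1) := by
    have h := kz_count2 f J (p - 1) (2 * p)
    rw [show p - 1 + 2 * p = 3 * p - 1 by omega] at h
    have h := congrArg (Nat.cast : ℕ → ZMod p) h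
    push_cast at h
    rw [Finset.sum_congr rfl (g := fun _ => (-1 : ZMod p)) (fun I hI => ?_)] at h
    · rw [Finset.sum_congr rfl (s₁ := ((J.powersetCard (3 * p - 1)).filter _)) (g := fun _ => (-1 : ZMod p)) (fun I hI => ?_)] at h
      · simp only [Finset.sum_const, smul_neg, nsmul_eq_mul, mul_one, neg_inj] at h
        exact h
      · simp only [Finset.mem_filter, Finset.mem_powersetCard] at hI
        exact hE1 I hI.1.1 (by omega) (by omega)
    · simp only [Finset.mem_filter, Finset.mem_powersetCard] at hI
      have := Finset.card_sdiff_of_subset hI.1.1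
      exact hE1 _ Finset.sdiff_subset (by omega) (by omega)
  have hB := kz_E1 hodd f J (by omega) (by omega)
  have hC := kz_E2 hodd f J (by omega) (by omega)
  rw [hsub J subset_rfl, h3p] at hB hC
  have hD : ∑ D ∈ J.powersetCard p, ((1 : ZMod p) - kzN f (J \ D) (p - 1) + kzN f (J \ D) (2 * p)
      + kzN f (J \ D) (2 * p - 1)) = 0 := by
    refine Finset.sum_eq_zero fun D hD => ?_
    rw [Finset.mem_powersetCard] at hD
    have c := Finset.card_sdiff_of_subset hD.1
    have := kz_E2 hodd f (J \ D) (by omega) (by omega)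
    rw [hsub _ Finset.sdiff_subset, kzN_big f (J \ D) (3 * p) (by omega),
      kzN_big f (J \ D) (3 * p - 1) (by omega)] at this
    push_cast at this
    linear_combination this
  rw [Finset.sum_add_distrib, Finset.sum_add_distrib, Finset.sum_sub_distrib] at hD
  have hcnt : ∀ k, ∑ D ∈ J.powersetCard p, (kzN f (J \ D) k : ZMod p) =
      ((#J - k).choose p : ZMod p) * kzN f J k := by
    intro k
    exact_mod_cast congrArg (Nat.cast : ℕ → ZMod p) (kz_count f J p k)
  rw [hcnt, hcnt, hcnt, Finset.sum_const, Finset.card_powersetCard, nsmul_eq_mul,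
    show #J = 3 * p + (p - 3) by omega,
    show 3 * p + (p - 3) - (p - 1) = 2 * p + (p - 2) by omega,
    show 3 * p + (p - 3) - (2 * p) = 1 * p + (p - 3) by omega,
    show 3 * p + (p - 3) - (2 * p - 1) = 1 * p + (p - 2) by omega,
    kz_choose _ _ (by omega), kz_choose _ _ (by omega), kz_choose _ _ (by omega),
    kz_choose _ _ (by omega)] at hD
  push_cast at hB hC hD
  have two : (2 : ZMod p) = 0 := by
    linear_combination hD - hC + hA
  have : ((2 : ℕ) : ZMod p) = 0 := by exact_mod_cast two
  rw [ZMod.natCast_eq_zero_iff] at this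
  have := Nat.le_of_dvd (by norm_num) this
  omega

/-- integral form of the statement -/
def kzP (n : ℕ) : Prop := ∀ (f : ℕ → ℤ × ℤ) (J : Finset ℕ), 4 * n - 3 ≤ J.card →
  ∃ I ⊆ J, I.card = n ∧ (n : ℤ) ∣ ∑ i ∈ I, (f i).1 ∧ (n : ℤ) ∣ ∑ i ∈ I, (f i).2

theorem kz_prime {p : ℕ} (hp : p.Prime) : kzP p := by
  intro f J hJ
  haveI : Fact p.Prime := ⟨hp⟩
  rcases hp.eq_two_or_odd' with rfl | hodd
  · obtain ⟨x, hx, y, hy, hxy, he⟩ := Finset.exists_ne_map_eq_of_card_lt_of_maps_to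
      (s := J) (t := (Finset.univ : Finset (ZMod 2 × ZMod 2)))
      (f := fun i => (((f i).1 : ZMod 2), ((f i).2 : ZMod 2)))
      (by simp [Finset.card_univ]; omega) (by intro a _; simp)
    simp only [Prod.mk.injEq] at he
    rw [ZMod.intCast_eq_intCast_iff, ZMod.intCast_eq_intCast_iff] at he
    refine ⟨{x, y}, ?_, Finset.card_pair hxy, ?_, ?_⟩
    · intro i hi
      simp at hi
      rcases hi with rfl | rfl <;> assumption
    · rw [Finset.sum_pair hxy]
      have := he.1
      simp only [Int.ModEq] at this
      push_cast at *
      omega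
    · rw [Finset.sum_pair hxy]
      have := he.2
      simp only [Int.ModEq] at this
      push_cast at *
      omega
  · obtain ⟨J', hJ', hc⟩ := Finset.exists_subset_card_eq hJ
    obtain ⟨I, hI, hIc, hs⟩ := kz_odd hodd
      (fun i => (((f i).1 : ZMod p), ((f i).2 : ZMod p))) J' hc
    refine ⟨I, hI.trans hJ', hIc, ?_, ?_⟩
    · rw [← ZMod.intCast_zmod_eq_zero_iff_dvd]
      have := congrArg Prod.fst hs
      rw [Prod.fst_sum] at this
      push_cast
      exact this
    · rw [← ZMod.intCast_zmod_eq_zero_iff_dvd]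
      have := congrArg Prod.snd hs
      rw [Prod.snd_sum] at this
      push_cast
      exact this

theorem kz_mul {m n : ℕ} (hm0 : 0 < m) (hn0 : 0 < n) (hm : kzP m) (hn : kzP n) : kzP (m * n) := by
  classical
  intro f J hJ
  have ext : ∀ k ≤ 4 * n - 3, ∃ g : ℕ → Finset ℕ, (∀ i < k, g i ⊆ J ∧ (g i).card = m ∧
      (m : ℤ) ∣ ∑ i ∈ g i, (f i).1 ∧ (m : ℤ) ∣ ∑ i ∈ g i, (f i).2) ∧
      ∀ i < k, ∀ j < k, i ≠ j → Disjoint (g i) (g j) := by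
    intro k
    induction k with
    | zero => intro _; exact ⟨fun _ => ∅, by simp, by simp⟩
    | succ k ih =>
      intro hk
      obtain ⟨g, hg, hd⟩ := ih (by omega)
      have hU : ((Finset.range k).biUnion g).card ≤ k * m := by
        refine Finset.card_biUnion_le.trans ?_
        rw [Finset.sum_congr rfl (g := fun _ => m) (fun i hi => (hg i (Finset.mem_range.1 hi)).2.1)]
        simp
      have h1 := Finset.le_card_sdiff ((Finset.range k).biUnion g) J
      obtain ⟨I, hI, hIp⟩ := hm f (J \ (Finset.range k).biUnion g) (by
        have : k * m ≤ (4 * n - 4) * m := Nat.mul_le_mul_right _ (by omega)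
        have h3 : (4 * n - 4) * m + 4 * m = 4 * (m * n) := by
          rw [← add_mul, Nat.sub_add_cancel (by omega)]; ring
        omega)
      rw [Finset.subset_sdiff] at hI
      have hdis : ∀ i < k, Disjoint I (g i) := fun i hi =>
        Finset.disjoint_of_subset_right (Finset.subset_biUnion_of_mem g (Finset.mem_range.2 hi)) hI.2
      refine ⟨fun i => if i < k then g i else I, ?_, ?_⟩
      · intro i hi
        by_cases h : i < k
        · simpa only [h, if_true] using hg i h
        · simpa only [h, if_false] using ⟨hI.1, hIp⟩
      · intro i hi j hj hij
        by_cases h : i < k <;> by_cases h' : j < k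
        · simpa [h, h'] using hd i h j h' hij
        · simpa [h, h'] using (hdis i h).symm
        · simpa [h, h'] using hdis j h'
        · omega
  obtain ⟨g, hg, hd⟩ := ext _ le_rfl
  obtain ⟨I, hI, hIc, h1, h2⟩ := hn (fun i => ((∑ j ∈ g i, (f j).1) / m, (∑ j ∈ g i, (f j).2) / m))
    (Finset.range (4 * n - 3)) (by simp)
  have hI' : ∀ i ∈ I, i < 4 * n - 3 := fun i hi => Finset.mem_range.1 (hI hi)
  have hpd : (I : Set ℕ).PairwiseDisjoint g := fun i hi j hj hij =>
    hd i (hI' i hi) j (hI' j hj) hij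
  refine ⟨I.biUnion g, Finset.biUnion_subset.2 fun i hi => (hg i (hI' i hi)).1, ?_, ?_, ?_⟩
  · rw [Finset.card_biUnion hpd, Finset.sum_congr rfl (fun i hi => (hg i (hI' i hi)).2.1)]
    simp [hIc, mul_comm]
  · rw [Finset.sum_biUnion hpd]
    have : ∑ x ∈ I, ∑ i ∈ g x, (f i).1 = m * ∑ x ∈ I, (∑ i ∈ g x, (f i).1) / m := by
      rw [Finset.mul_sum]
      exact Finset.sum_congr rfl fun i hi => (Int.mul_ediv_cancel' (hg i (hI' i hi)).2.2.1).symm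
    rw [this]; push_cast
    exact mul_dvd_mul_left _ h1
  · rw [Finset.sum_biUnion hpd]
    have : ∑ x ∈ I, ∑ i ∈ g x, (f i).2 = m * ∑ x ∈ I, (∑ i ∈ g x, (f i).2) / m := by
      rw [Finset.mul_sum]
      exact Finset.sum_congr rfl fun i hi => (Int.mul_ediv_cancel' (hg i (hI' i hi)).2.2.2).symm
    rw [this]; push_cast
    exact mul_dvd_mul_left _ h2

theorem kz_all (n : ℕ) : kzP n := by
  induction n using induction_on_primes with
  | zero => intro f J _; exact ⟨∅, by simp⟩
  | one =>
    intro f J hJ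
    obtain ⟨x, hx⟩ := Finset.card_pos.1 (show 0 < J.card by omega)
    exact ⟨{x}, by simpa using hx, by simp⟩
  | prime_mul p a hp ih =>
    rcases Nat.eq_zero_or_pos a with rfl | ha
    · intro f J _; exact ⟨∅, by simp⟩
    · exact kz_mul hp.pos ha (kz_prime hp) ih

theorem kemnitz (n : ℕ) (hn : 0 < n) (J : Multiset (ZMod n × ZMod n))
    (hJ : Multiset.card J = 4 * n - 3) :
    ∃ S ≤ J, Multiset.card S = n ∧ S.sum = 0 := by
  haveI : NeZero n := ⟨hn.ne'⟩
  induction J using Quotient.inductionOn with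
  | h l =>
  let g : ℕ → ZMod n × ZMod n := fun i => l.getD i 0
  have hl : (⟦l⟧ : Multiset (ZMod n × ZMod n)) = (Finset.range l.length).val.map g := by
    have : l = (List.range l.length).map g := by
      apply List.ext_getElem
      · simp
      · intro i h1 h2
        simp [g, h1]
    conv_lhs => rw [this]
    rfl
  obtain ⟨I, hI, hc, h1, h2⟩ := kz_all n (fun i => (((g i).1.val : ℤ), ((g i).2.val : ℤ)))
    (Finset.range l.length) (by
      simp at hJ
      simp [hJ])
  refine ⟨I.val.map g, ?_, ?_, ?_⟩
  · rw [hl]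
    exact Multiset.map_le_map (Finset.val_le_iff.2 hI)
  · simpa using hc
  · change ∑ i ∈ I, g i = 0
    rw [← ZMod.intCast_zmod_eq_zero_iff_dvd] at h1 h2
    push_cast at h1 h2
    simp only [ZMod.natCast_zmod_val] at h1 h2
    rw [Prod.ext_iff, Prod.fst_sum, Prod.snd_sum]
    exact ⟨h1, h2⟩
end

section
/- If d divides n and J is a zero-sum sequence in (ℤ/nℤ)² of length 4n - d, then J contains a zero-sum subsequence of length n. -/
theorem altsum {ι : Type} [DecidableEq ι] {R : Type} [CommRing R] (X : Finset ι) (P : MvPolynomial ι R)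
    (hP : P.totalDegree < X.card) :
    ∑ I ∈ X.powerset, (-1 : R) ^ I.card * MvPolynomial.eval (fun i => if i ∈ I then 1 else 0) P = 0 := by
  simp_rw [MvPolynomial.eval_eq, Finset.mul_sum]
  rw [Finset.sum_comm]
  refine Finset.sum_eq_zero fun m hm => ?_
  have h1 : m.support.card < X.card := by
    refine lt_of_le_of_lt ?_ hP
    refine le_trans ?_ (MvPolynomial.le_totalDegree hm)
    rw [Finset.card_eq_sum_ones]
    exact Finset.sum_le_sum fun i hi => Nat.one_le_iff_ne_zero.mpr (Finsupp.mem_support_iff.mp hi)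
  obtain ⟨x, hx, hxm⟩ := Finset.exists_mem_notMem_of_card_lt_card h1
  obtain ⟨Y, hxY, rfl⟩ : ∃ Y, x ∉ Y ∧ X = insert x Y :=
    ⟨X.erase x, Finset.notMem_erase _ _, (Finset.insert_erase hx).symm⟩
  rw [Finset.sum_powerset_insert hxY, ← Finset.sum_add_distrib]
  refine Finset.sum_eq_zero fun I hI => ?_
  have hxI : x ∉ I := fun h => hxY (Finset.mem_powerset.mp hI h)
  rw [Finset.card_insert_of_notMem hxI]
  have : ∏ i ∈ m.support, (if i ∈ insert x I then (1:R) else 0) ^ m i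
      = ∏ i ∈ m.support, (if i ∈ I then (1:R) else 0) ^ m i := by
    refine Finset.prod_congr rfl fun i hi => ?_
    have : i ≠ x := fun h => hxm (h ▸ hi)
    simp [Finset.mem_insert, this]
  rw [this]; ring

def Zs {ι : Type} (n : ℕ) (a b : ι → ℤ) (S : Finset ι) : Prop :=
  (n : ℤ) ∣ ∑ i ∈ S, a i ∧ (n : ℤ) ∣ ∑ i ∈ S, b i

instance {ι : Type} (n : ℕ) (a b : ι → ℤ) : DecidablePred (Zs n a b) := fun _ => by
  unfold Zs; infer_instance

open MvPolynomial in
theorem evalLin {ι : Type} [DecidableEq ι] {R : Type} [CommRing R] (X I : Finset ι) (h : I ⊆ X)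
    (a : ι → R) : eval (fun i => if i ∈ I then (1:R) else 0) (∑ i ∈ X, C (a i) * MvPolynomial.X i)
      = ∑ i ∈ I, a i := by
  simp only [map_sum, map_mul, eval_C, eval_X, mul_ite, mul_one, mul_zero]
  rw [← Finset.sum_filter, Finset.filter_mem_eq_inter, Finset.inter_eq_right.mpr h]

open MvPolynomial in
theorem degLin {ι : Type} {R : Type} [CommRing R] (X : Finset ι)
    (a : ι → R) : (∑ i ∈ X, C (a i) * MvPolynomial.X i).totalDegree ≤ 1 := by
  refine totalDegree_finsetSum_le fun i _ => ?_
  refine (totalDegree_mul _ _).trans ?_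
  rw [totalDegree_C, zero_add, MvPolynomial.X]
  refine (totalDegree_monomial_le _ _).trans ?_
  simp

theorem cw {ι : Type} [DecidableEq ι] (p : ℕ) [Fact p.Prime] (a b : ι → ℤ) (X : Finset ι)
    (Q : Polynomial (ZMod p)) (e : ℕ) (hQ : Q.natDegree ≤ e) (hX : 2 * (p - 1) + e < X.card) :
    ∑ I ∈ X.powerset with Zs p a b I, (-1 : ZMod p) ^ I.card * Q.eval (I.card : ZMod p) = 0 := by
  let L : (ι → ZMod p) → MvPolynomial ι (ZMod p) := fun a => ∑ i ∈ X, MvPolynomial.C (a i) * MvPolynomial.X i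
  let P : MvPolynomial ι (ZMod p) := (1 - L (fun i => (a i : ZMod p)) ^ (p-1)) *
    (1 - L (fun i => (b i : ZMod p)) ^ (p-1)) *
    ∑ k ∈ Finset.range (e+1), MvPolynomial.C (Q.coeff k) * L (fun _ => 1) ^ k
  have hd : ∀ c k, (L c ^ k).totalDegree ≤ k := fun c k => by
    refine (MvPolynomial.totalDegree_pow _ _).trans ?_
    have := degLin X c
    exact (Nat.mul_le_mul_left k this).trans (by simp)
  have hd1 : ∀ c, (1 - L c ^ (p-1)).totalDegree ≤ p - 1 := fun c => by
    refine (MvPolynomial.totalDegree_sub _ _).trans ?_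
    simpa using hd c (p-1)
  have hP : P.totalDegree < X.card := by
    refine lt_of_le_of_lt ?_ hX
    refine (MvPolynomial.totalDegree_mul _ _).trans (add_le_add ?_ ?_)
    · refine (MvPolynomial.totalDegree_mul _ _).trans ?_
      have := hd1 (fun i => (a i : ZMod p)); have := hd1 (fun i => (b i : ZMod p)); omega
    · refine MvPolynomial.totalDegree_finsetSum_le fun k hk => ?_
      refine (MvPolynomial.totalDegree_mul _ _).trans ?_
      have := hd (fun _ => 1) k
      have := Finset.mem_range.mp hk
      rw [MvPolynomial.totalDegree_C]; omega
  have hpos : p - 1 ≠ 0 := by have := (Fact.out : p.Prime).two_le; omega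
  have fer : ∀ (z : ℤ), (1 - (z : ZMod p)^(p-1)) = if (p:ℤ) ∣ z then 1 else 0 := fun z => by
    split_ifs with h
    · rw [(ZMod.intCast_zmod_eq_zero_iff_dvd z p).mpr h, zero_pow hpos, sub_zero]
    · rw [ZMod.pow_card_sub_one_eq_one, sub_self]
      exact fun h' => h ((ZMod.intCast_zmod_eq_zero_iff_dvd z p).mp h')
  rw [← altsum X P hP, Finset.sum_filter]
  refine Finset.sum_congr rfl fun I hI => ?_
  have hI := Finset.mem_powerset.mp hI
  have : MvPolynomial.eval (fun i => if i ∈ I then 1 else 0) P = if Zs p a b I then Q.eval (I.card : ZMod p) else 0 := by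
    have hL : ∀ c, MvPolynomial.eval (fun i => if i ∈ I then 1 else 0) (L c) = ∑ i ∈ I, c i :=
      fun c => evalLin X I hI c
    simp only [P, map_mul, map_sub, map_one, map_pow, map_sum, hL]
    rw [← Int.cast_sum, ← Int.cast_sum, fer, fer]
    simp only [MvPolynomial.eval_C, Finset.sum_const, nsmul_eq_mul, mul_one]
    rw [← Polynomial.eval_eq_sum_range' (by omega)]
    unfold Zs
    split_ifs <;> simp_all
  rw [this, mul_ite, mul_zero]

def Nz {ι : Type} (p : ℕ) (a b : ι → ℤ) (X : Finset ι) (k : ℕ) : ℕ :=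
  ((X.powersetCard k).filter (Zs p a b)).card

theorem sumN {ι : Type} (p : ℕ) (a b : ι → ℤ) (X : Finset ι) (w : ℕ → ZMod p) :
    ∑ I ∈ X.powerset with Zs p a b I, w I.card
      = ∑ k ∈ Finset.range (X.card + 1), (Nz p a b X k : ZMod p) * w k := by
  rw [Finset.sum_filter, Finset.sum_powerset]
  refine Finset.sum_congr rfl fun k _ => ?_
  rw [← Finset.sum_filter, Nz, ← nsmul_eq_mul, ← Finset.sum_const]
  refine Finset.sum_congr rfl fun I hI => ?_
  rw [(Finset.mem_powersetCard.mp (Finset.mem_filter.mp hI).1).2]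

def dl (p : ℕ) (c : ZMod p) (k : ℕ) : ZMod p := if (k : ZMod p) = c then 1 else 0

theorem dl_eq (p : ℕ) [Fact p.Prime] (c : ZMod p) (k : ℕ) :
    dl p c k = 1 - ((k : ZMod p) - c) ^ (p-1) := by
  have hpos : p - 1 ≠ 0 := by have := (Fact.out : p.Prime).two_le; omega
  unfold dl
  split_ifs with h
  · rw [h, sub_self, zero_pow hpos, sub_zero]
  · rw [ZMod.pow_card_sub_one_eq_one (sub_ne_zero.mpr h), sub_self]

theorem cw2 {ι : Type} [DecidableEq ι] (p : ℕ) [Fact p.Prime] (a b : ι → ℤ) (X : Finset ι)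
    (c : ZMod p) (hX : 3 * p - 2 ≤ X.card) :
    ∑ I ∈ X.powerset with Zs p a b I, (-1 : ZMod p) ^ I.card * dl p c I.card = 0 := by
  have h2 := (Fact.out : p.Prime).two_le
  rw [← cw p a b X (1 - (Polynomial.X - Polynomial.C c) ^ (p-1)) (p-1) ?_ (by omega)]
  · refine Finset.sum_congr rfl fun I _ => ?_
    rw [dl_eq]; simp
  · refine (Polynomial.natDegree_sub_le _ _).trans ?_
    refine max_le (by simp) ?_
    refine Polynomial.natDegree_pow_le.trans ?_
    simp

theorem cw1 {ι : Type} [DecidableEq ι] (p : ℕ) [Fact p.Prime] (a b : ι → ℤ) (X : Finset ι)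
    (hX : X.card = 3 * p - 3) :
    ∑ I ∈ X.powerset with Zs p a b I, (-1 : ZMod p) ^ I.card * (dl p 0 I.card - dl p (-1) I.card) = 0 := by
  have h2 := (Fact.out : p.Prime).two_le
  refine Eq.trans ?_ (cw p a b X
    ((Polynomial.X - Polynomial.C (-1)) ^ (p-1) - (Polynomial.X - Polynomial.C 0) ^ (p-1)) (p-2) ?_ (by omega))
  · refine Finset.sum_congr rfl fun I _ => ?_
    rw [dl_eq, dl_eq]; simp
  · have m : ∀ c : ZMod p, ((Polynomial.X - Polynomial.C c) ^ (p-1)).Monic :=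
      fun c => (Polynomial.monic_X_sub_C c).pow _
    have d : ∀ c : ZMod p, ((Polynomial.X - Polynomial.C c) ^ (p-1)).degree = ((p - 1 : ℕ) : WithBot ℕ) :=
      fun c => by rw [Polynomial.degree_pow, Polynomial.degree_X_sub_C]; simp
    have := Polynomial.degree_sub_lt_left ((d (-1)).trans (d 0).symm) (m _).ne_zero
      ((m _).leadingCoeff.trans (m _).leadingCoeff.symm)
    rw [d] at this
    by_cases h0 : ((Polynomial.X - Polynomial.C (-1 : ZMod p)) ^ (p-1) - (Polynomial.X - Polynomial.C 0) ^ (p-1)) = 0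
    · rw [h0]; simp
    · have := (Polynomial.natDegree_lt_iff_degree_lt h0).mpr this
      omega

theorem cnt {ι : Type} [DecidableEq ι] (X I : Finset ι) (hI : I ⊆ X) (m : ℕ) (hm : m ≤ X.card) :
    ((X.powersetCard m).filter (I ⊆ ·)).card = (X.card - I.card).choose (X.card - m) := by
  rw [← Finset.card_sdiff_of_subset hI, ← Finset.card_powersetCard]
  refine Finset.card_bij' (fun Y _ => X \ Y) (fun Y _ => X \ Y) ?_ ?_ ?_ ?_
  · intro Y hY
    simp only [Finset.mem_filter, Finset.mem_powersetCard] at hY ⊢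
    obtain ⟨⟨h1, h2⟩, h3⟩ := hY
    exact ⟨Finset.sdiff_subset_sdiff subset_rfl h3, by rw [Finset.card_sdiff_of_subset h1, h2]⟩
  · intro Y hY
    simp only [Finset.mem_filter, Finset.mem_powersetCard] at hY ⊢
    obtain ⟨h1, h2⟩ := hY
    have h3 : Y ⊆ X := h1.trans Finset.sdiff_subset
    refine ⟨⟨Finset.sdiff_subset, by rw [Finset.card_sdiff_of_subset h3, h2]; omega⟩, ?_⟩
    intro x hx
    refine Finset.mem_sdiff.mpr ⟨hI hx, fun h => (Finset.mem_sdiff.mp (h1 h)).2 hx⟩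
  · intro Y hY
    simp only [Finset.mem_filter, Finset.mem_powersetCard] at hY
    simp [hY.1.1]
  · intro Y hY
    simp only [Finset.mem_powersetCard] at hY
    have h3 : Y ⊆ X := hY.1.trans Finset.sdiff_subset
    simp [h3]

theorem cw6 {ι : Type} [DecidableEq ι] (p : ℕ) [Fact p.Prime] (a b : ι → ℤ) (X : Finset ι)
    (hX : X.card = 4 * p - 3) :
    ∑ I ∈ X.powerset with Zs p a b I, (-1 : ZMod p) ^ I.card * (dl p 0 I.card - dl p (-1) I.card)
      * ((4 * p - 3 - I.card).choose p : ℕ) = 0 := by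
  have h2 := (Fact.out : p.Prime).two_le
  have h : ∑ Y ∈ X.powersetCard (3 * p - 3), ∑ I ∈ Y.powerset with Zs p a b I,
      (-1 : ZMod p) ^ I.card * (dl p 0 I.card - dl p (-1) I.card) = 0 :=
    Finset.sum_eq_zero fun Y hY => cw1 p a b Y (Finset.mem_powersetCard.mp hY).2
  refine Eq.trans ?_ h
  rw [Finset.sum_comm' (t' := X.powerset.filter (Zs p a b))
    (s' := fun I => (X.powersetCard (3 * p - 3)).filter (I ⊆ ·))]
  · refine Finset.sum_congr rfl fun I hI => ?_
    rw [Finset.sum_const, cnt X I (Finset.mem_powerset.mp (Finset.mem_filter.mp hI).1) _ (by omega), hX,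
      nsmul_eq_mul, mul_comm]
    congr 4
    omega
  · intro Y I
    simp only [Finset.mem_filter, Finset.mem_powersetCard, Finset.mem_powerset]
    constructor
    · rintro ⟨⟨h1, h2⟩, h3, h4⟩
      exact ⟨⟨⟨h1, h2⟩, h3⟩, h3.trans h1, h4⟩
    · rintro ⟨⟨⟨h1, h2⟩, h3⟩, h5, h4⟩
      exact ⟨⟨h1, h2⟩, h3, h4⟩

theorem Zs.sdiff {ι : Type} [DecidableEq ι] {p : ℕ} {a b : ι → ℤ} {X S : Finset ι}
    (hX : Zs p a b X) (h : S ⊆ X) (hS : Zs p a b S) : Zs p a b (X \ S) := by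
  constructor
  · rw [Finset.sum_sdiff_eq_sub h]; exact dvd_sub hX.1 hS.1
  · rw [Finset.sum_sdiff_eq_sub h]; exact dvd_sub hX.2 hS.2

theorem Zs.union {ι : Type} [DecidableEq ι] {p : ℕ} {a b : ι → ℤ} {X S : Finset ι}
    (hX : Zs p a b X) (h : Disjoint X S) (hS : Zs p a b S) : Zs p a b (X ∪ S) := by
  constructor
  · rw [Finset.sum_union h]; exact dvd_add hX.1 hS.1
  · rw [Finset.sum_union h]; exact dvd_add hX.2 hS.2

theorem Zs.empty {ι : Type} {p : ℕ} {a b : ι → ℤ} : Zs p a b ∅ := by simp [Zs]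

theorem Nz_zero {ι : Type} (p : ℕ) (a b : ι → ℤ) (X : Finset ι) : Nz p a b X 0 = 1 := by
  simp [Nz, Finset.filter_singleton, Zs.empty]

theorem dl_zero (p k : ℕ) : dl p 0 k = if p ∣ k then 1 else 0 := by
  simp only [dl, ZMod.natCast_eq_zero_iff]

theorem dl_neg (p k : ℕ) : dl p (-1) k = if p ∣ k + 1 then 1 else 0 := by
  simp only [dl, ← ZMod.natCast_eq_zero_iff, Nat.cast_add, Nat.cast_one, eq_neg_iff_add_eq_zero]

theorem propC {ι : Type} [DecidableEq ι] (p : ℕ) [Fact p.Prime] (a b : ι → ℤ) (X : Finset ι)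
    (hX : X.card = 3 * p - 2) : ∃ S ⊆ X, (S.card = p ∨ S.card = 2 * p) ∧ Zs p a b S := by
  have h2 := (Fact.out : p.Prime).two_le
  by_contra! hc
  have h := cw2 p a b X 0 hX.ge
  rw [Finset.sum_eq_single_of_mem ∅ (by simp [Zs.empty])] at h
  · simp [dl] at h
  · intro I hI h0
    simp only [Finset.mem_filter, Finset.mem_powerset] at hI
    rw [dl_zero, if_neg, mul_zero]
    rintro ⟨c, hcc⟩
    have hle := Finset.card_le_card hI.1
    have hpos := Finset.card_pos.mpr (Finset.nonempty_iff_ne_empty.mpr h0)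
    have : c < 3 := by
      by_contra! h3
      have := Nat.mul_le_mul_left p h3
      omega
    have hc' := hc I hI.1
    interval_cases c
    · omega
    · exact hc' (Or.inl (by omega)) hI.2
    · exact hc' (Or.inr (by omega)) hI.2

theorem propBp {ι : Type} [DecidableEq ι] (p : ℕ) [Fact p.Prime] (a b : ι → ℤ) (X : Finset ι)
    (hX : X.card = 3 * p) (hz : Zs p a b X) : ∃ S ⊆ X, S.card = p ∧ Zs p a b S := by
  obtain ⟨Y, hY, hYc⟩ := Finset.exists_subset_card_eq (s := X) (n := 3 * p - 2) (by omega)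
  obtain ⟨S, hS, h | h, hSz⟩ := propC p a b Y hYc
  · exact ⟨S, hS.trans hY, h, hSz⟩
  · refine ⟨X \ S, Finset.sdiff_subset, ?_, hz.sdiff (hS.trans hY) hSz⟩
    rw [Finset.card_sdiff_of_subset (hS.trans hY)]; omega

theorem lucas (p q r : ℕ) [Fact p.Prime] (hr : r < p) : (((q * p + r).choose p : ℕ) : ZMod p) = q := by
  have h2 := (Fact.out : p.Prime).pos
  rw [ZMod.natCast_eq_natCast_iff]
  have := @Choose.choose_modEq_choose_mod_mul_choose_div_nat (q * p + r) p p _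
  rw [Nat.mod_self, Nat.div_self h2, Nat.choose_zero_right, Nat.choose_one_right, one_mul, mul_comm q p,
    Nat.mul_add_div h2, Nat.div_eq_of_lt hr] at this
  rwa [mul_comm q p]

theorem Nz_eq_zero {ι : Type} {p : ℕ} {a b : ι → ℤ} {X : Finset ι} {k : ℕ}
    (h : ∀ S ⊆ X, S.card = k → ¬ Zs p a b S) : Nz p a b X k = 0 := by
  rw [Nz, Finset.card_eq_zero, Finset.filter_eq_empty_iff]
  intro S hS
  rw [Finset.mem_powersetCard] at hS
  exact h S hS.1 hS.2

theorem dvd_cases {p k : ℕ} (h : p ∣ k) (hk : k < 4 * p) : k = 0 ∨ k = p ∨ k = 2 * p ∨ k = 3 * p := by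
  obtain ⟨c, rfl⟩ := h
  have : c < 4 := by
    by_contra! h3
    have := Nat.mul_le_mul_left p h3
    omega
  interval_cases c <;> omega

theorem N2p {ι : Type} [DecidableEq ι] (p : ℕ) [Fact p.Prime] (hodd : Odd p) (a b : ι → ℤ) (X : Finset ι)
    (h1 : 3 * p - 2 ≤ X.card) (h2 : X.card ≤ 3 * p - 1) (hno : ∀ S ⊆ X, S.card = p → ¬ Zs p a b S) :
    (Nz p a b X (2 * p) : ZMod p) = -1 := by
  have hp := (Fact.out : p.Prime).two_le
  have h := cw2 p a b X 0 h1
  rw [sumN p a b X (fun k => (-1 : ZMod p) ^ k * dl p 0 k)] at h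
  rw [← Finset.sum_subset (s₁ := {0, p, 2 * p})] at h
  · rw [Finset.sum_insert, Finset.sum_insert, Finset.sum_singleton, Nz_zero, Nz_eq_zero hno] at h
    · simp only [dl_zero] at h
      simp at h
      linear_combination h
    · simp; omega
    · simp; omega
  · intro k hk
    simp at hk ⊢
    omega
  · intro k hk hk'
    simp at hk hk'
    rw [dl_zero, if_neg]
    · simp
    · intro h
      have := dvd_cases h (by omega)
      omega

theorem step7 {ι : Type} [DecidableEq ι] (p : ℕ) [Fact p.Prime] (hodd : Odd p) (a b : ι → ℤ) (X : Finset ι)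
    (hX : X.card = 4 * p - 3) (hno : ∀ S ⊆ X, S.card = p → ¬ Zs p a b S) :
    (Nz p a b X (p - 1) : ZMod p) = Nz p a b X (3 * p - 1) := by
  have hp := (Fact.out : p.Prime).two_le
  have key : ∑ A ∈ (X.powersetCard (p-1)).filter (Zs p a b),
      ∑ D ∈ ((X.powersetCard (3 * p-1)).filter (Zs p a b)).filter (A ⊆ ·), (1 : ZMod p)
    = ∑ D ∈ (X.powersetCard (3 * p-1)).filter (Zs p a b),
      ∑ A ∈ ((X.powersetCard (p-1)).filter (Zs p a b)).filter (· ⊆ D), (1 : ZMod p) := by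
    refine Finset.sum_comm' ?_
    intro A D
    simp only [Finset.mem_filter]
    tauto
  have e1 : ∀ A ∈ (X.powersetCard (p-1)).filter (Zs p a b),
      ∑ D ∈ ((X.powersetCard (3 * p-1)).filter (Zs p a b)).filter (A ⊆ ·), (1 : ZMod p) = -1 := by
    intro A hA
    simp only [Finset.mem_filter, Finset.mem_powersetCard] at hA
    obtain ⟨⟨hAX, hAc⟩, hAz⟩ := hA
    rw [← N2p p hodd a b (X \ A) (by rw [Finset.card_sdiff_of_subset hAX]; omega)
      (by rw [Finset.card_sdiff_of_subset hAX]; omega)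
      (fun S hS => hno S (hS.trans Finset.sdiff_subset)), Nz, Finset.sum_const, nsmul_eq_mul, mul_one]
    congr 1
    refine Finset.card_bij' (fun D _ => D \ A) (fun C _ => A ∪ C) ?_ ?_ ?_ ?_
    · intro D hD
      simp only [Finset.mem_filter, Finset.mem_powersetCard] at hD ⊢
      obtain ⟨⟨⟨h1, h2⟩, h3⟩, h4⟩ := hD
      refine ⟨⟨Finset.sdiff_subset_sdiff h1 subset_rfl, ?_⟩, h3.sdiff h4 hAz⟩
      rw [Finset.card_sdiff_of_subset h4]; omega
    · intro C hC
      simp only [Finset.mem_filter, Finset.mem_powersetCard] at hC ⊢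
      obtain ⟨⟨h1, h2⟩, h3⟩ := hC
      have hd : Disjoint A C := (Finset.subset_sdiff.mp h1).2.symm
      refine ⟨⟨⟨Finset.union_subset hAX (h1.trans Finset.sdiff_subset), ?_⟩, hAz.union hd h3⟩,
        Finset.subset_union_left⟩
      rw [Finset.card_union_of_disjoint hd]; omega
    · intro D hD
      simp only [Finset.mem_filter] at hD
      exact Finset.union_sdiff_of_subset hD.2
    · intro C hC
      simp only [Finset.mem_filter, Finset.mem_powersetCard] at hC
      have hd : Disjoint A C := (Finset.subset_sdiff.mp hC.1.1).2.symm
      exact Finset.union_sdiff_cancel_left hd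
  have e2 : ∀ D ∈ (X.powersetCard (3 * p-1)).filter (Zs p a b),
      ∑ A ∈ ((X.powersetCard (p-1)).filter (Zs p a b)).filter (· ⊆ D), (1 : ZMod p) = -1 := by
    intro D hD
    simp only [Finset.mem_filter, Finset.mem_powersetCard] at hD
    obtain ⟨⟨hDX, hDc⟩, hDz⟩ := hD
    rw [← N2p p hodd a b D (by omega) (by omega)
      (fun S hS => hno S (hS.trans hDX)), Nz, Finset.sum_const, nsmul_eq_mul, mul_one]
    congr 1
    refine Finset.card_bij' (fun A _ => D \ A) (fun C _ => D \ C) ?_ ?_ ?_ ?_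
    · intro A hA
      simp only [Finset.mem_filter, Finset.mem_powersetCard] at hA ⊢
      obtain ⟨⟨⟨h1, h2⟩, h3⟩, h4⟩ := hA
      refine ⟨⟨Finset.sdiff_subset, ?_⟩, hDz.sdiff h4 h3⟩
      rw [Finset.card_sdiff_of_subset h4]; omega
    · intro C hC
      simp only [Finset.mem_filter, Finset.mem_powersetCard] at hC ⊢
      obtain ⟨⟨h1, h2⟩, h3⟩ := hC
      refine ⟨⟨⟨Finset.sdiff_subset.trans hDX, ?_⟩, hDz.sdiff h1 h3⟩, Finset.sdiff_subset⟩
      rw [Finset.card_sdiff_of_subset h1]; omega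
    · intro A hA
      simp only [Finset.mem_filter] at hA
      simp [hA.2]
    · intro C hC
      simp only [Finset.mem_filter, Finset.mem_powersetCard] at hC
      simp [hC.1.1]
  rw [Finset.sum_congr rfl e1, Finset.sum_congr rfl e2] at key
  simpa [Nz] using key

theorem kemOdd {ι : Type} [DecidableEq ι] (p : ℕ) [Fact p.Prime] (hodd : Odd p) (a b : ι → ℤ) (X : Finset ι)
    (hX : X.card = 4 * p - 3) : ∃ S ⊆ X, S.card = p ∧ Zs p a b S := by
  have hp := (Fact.out : p.Prime).two_le
  have hp3 : 3 ≤ p := by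
    obtain ⟨c, hc⟩ := hodd
    omega
  by_contra! hno
  have h7 := step7 p hodd a b X hX hno
  have h3p : Nz p a b X (3 * p) = 0 := Nz_eq_zero fun S hS hc hz => by
    obtain ⟨T, hT, hTc, hTz⟩ := propBp p a b S hc hz
    exact hno T (hT.trans hS) hTc hTz
  have hp0 : Nz p a b X p = 0 := Nz_eq_zero hno
  have t1 := cw2 p a b X 0 (by omega)
  have t2 := cw2 p a b X (-1) (by omega)
  have t3 := cw6 p a b X hX
  rw [sumN p a b X (fun k => (-1 : ZMod p) ^ k * dl p 0 k)] at t1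
  rw [sumN p a b X (fun k => (-1 : ZMod p) ^ k * dl p (-1) k)] at t2
  rw [sumN p a b X (fun k => (-1 : ZMod p) ^ k * (dl p 0 k - dl p (-1) k)
      * ((4 * p - 3 - k).choose p : ℕ))] at t3
  let W : ℕ → ZMod p := fun k => (-1 : ZMod p) ^ k * (- dl p 0 k + dl p (-1) k
    + (dl p 0 k - dl p (-1) k) * ((4 * p - 3 - k).choose p : ℕ))
  have t : ∑ k ∈ Finset.range (X.card + 1), (Nz p a b X k : ZMod p) * W k = 0 := by
    have e := congrArg₂ (· + ·) (congrArg₂ (· + ·) (congrArg Neg.neg t1) t2) t3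
    rw [← Finset.sum_neg_distrib, ← Finset.sum_add_distrib, ← Finset.sum_add_distrib] at e
    refine Eq.trans (Finset.sum_congr rfl fun k _ => ?_) (e.trans (by simp))
    simp only [W]; ring
  have d0 : ∀ k, ¬ p ∣ k → dl p 0 k = 0 := fun k h => by rw [dl_zero, if_neg h]
  have d0' : ∀ k, p ∣ k → dl p 0 k = 1 := fun k h => by rw [dl_zero, if_pos h]
  have d1 : ∀ k, ¬ p ∣ k + 1 → dl p (-1) k = 0 := fun k h => by rw [dl_neg, if_neg h]
  have d1' : ∀ k, p ∣ k + 1 → dl p (-1) k = 1 := fun k h => by rw [dl_neg, if_pos h]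
  have nd : ∀ k, k < 4 * p → k ≠ 0 → k ≠ p → k ≠ 2 * p → k ≠ 3 * p → ¬ p ∣ k := by
    intro k h1 h2 h3 h4 h5 h
    have := dvd_cases h h1
    omega
  have w0 : W 0 = 2 := by
    have := lucas p 3 (p-3) (by omega)
    rw [show 3 * p + (p - 3) = 4 * p - 3 - 0 by omega] at this
    simp only [W]
    rw [d0' 0 (by simp), d1 0 (nd _ (by omega) (by omega) (by omega) (by omega) (by omega)), this]
    push_cast; ring
  have w1 : W (p-1) = -1 := by
    have := lucas p 2 (p-2) (by omega)
    rw [show 2 * p + (p - 2) = 4 * p - 3 - (p-1) by omega] at this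
    simp only [W]
    rw [d0 _ (nd _ (by omega) (by omega) (by omega) (by omega) (by omega)),
      d1' _ (by rw [Nat.sub_add_cancel (by omega)]), this,
      Even.neg_one_pow (by obtain ⟨c, hc⟩ := hodd; exact ⟨c, by omega⟩)]
    push_cast; ring
  have w2 : W (2*p-1) = 0 := by
    have := lucas p 1 (p-2) (by omega)
    rw [show 1 * p + (p - 2) = 4 * p - 3 - (2*p-1) by omega] at this
    simp only [W]
    rw [d0 _ (nd _ (by omega) (by omega) (by omega) (by omega) (by omega)),
      d1' _ (by rw [Nat.sub_add_cancel (by omega)]; exact Dvd.intro_left _ rfl), this]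
    push_cast; ring
  have w3 : W (2*p) = 0 := by
    have := lucas p 1 (p-3) (by omega)
    rw [show 1 * p + (p - 3) = 4 * p - 3 - (2*p) by omega] at this
    simp only [W]
    rw [d1 _ (nd _ (by omega) (by omega) (by omega) (by omega) (by omega)),
      d0' _ (Dvd.intro_left _ rfl), this]
    push_cast; ring
  have w4 : W (3*p-1) = 1 := by
    simp only [W]
    rw [d0 _ (nd _ (by omega) (by omega) (by omega) (by omega) (by omega)),
      d1' _ (by rw [Nat.sub_add_cancel (by omega)]; exact Dvd.intro_left _ rfl),
      Nat.choose_eq_zero_of_lt (by omega),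
      Even.neg_one_pow (by obtain ⟨c, hc⟩ := hodd; exact ⟨3 * c + 1, by omega⟩)]
    push_cast; ring
  rw [← Finset.sum_subset (s₁ := {0, p-1, p, 2 * p - 1, 2 * p, 3 * p - 1, 3 * p})] at t
  · rw [Finset.sum_insert, Finset.sum_insert, Finset.sum_insert, Finset.sum_insert, Finset.sum_insert,
      Finset.sum_insert, Finset.sum_singleton, Nz_zero, hp0, h3p, w0, w1, w2, w3, w4] at t
    · have h2 : ((2 : ℕ) : ZMod p) = 0 := by
        push_cast at t ⊢
        linear_combination t + h7
      rw [ZMod.natCast_eq_zero_iff] at h2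
      have := Nat.le_of_dvd (by norm_num) h2
      omega
    all_goals simp only [Finset.mem_insert, Finset.mem_singleton]; omega
  · intro k hk
    simp only [Finset.mem_insert, Finset.mem_singleton, Finset.mem_range] at hk ⊢
    omega
  · intro k hk hk'
    simp only [Finset.mem_insert, Finset.mem_singleton, Finset.mem_range, not_or] at hk hk'
    simp only [W]
    rw [d0 k (nd _ (by omega) (by omega) (by omega) (by omega) (by omega)),
      d1 k (nd _ (by omega) (by omega) (by omega) (by omega) (by omega))]
    ring

theorem kemTwo {ι : Type} [DecidableEq ι] (a b : ι → ℤ) (X : Finset ι)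
    (hX : X.card = 5) : ∃ S ⊆ X, S.card = 2 ∧ Zs 2 a b S := by
  obtain ⟨x, hx, y, hy, hxy, h⟩ := Finset.exists_ne_map_eq_of_card_lt_of_maps_to
    (s := X) (t := (Finset.univ : Finset (ZMod 2 × ZMod 2)))
    (f := fun i => ((a i : ZMod 2), (b i : ZMod 2))) (by rw [hX]; decide) (fun _ _ => Finset.mem_univ _)
  refine ⟨{x, y}, ?_, Finset.card_pair hxy, ?_⟩
  · intro z hz
    simp only [Finset.mem_insert, Finset.mem_singleton] at hz
    rcases hz with rfl | rfl <;> assumption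
  · simp only [Prod.mk.injEq] at h
    have h1 := (ZMod.intCast_eq_intCast_iff_dvd_sub _ _ _).mp h.1
    have h2 := (ZMod.intCast_eq_intCast_iff_dvd_sub _ _ _).mp h.2
    constructor <;> rw [Finset.sum_pair hxy] <;> push_cast at * <;> omega

def Kem (n : ℕ) : Prop := ∀ (ι : Type) [DecidableEq ι] (a b : ι → ℤ) (X : Finset ι),
  4 * n - 3 ≤ X.card → ∃ S ⊆ X, S.card = n ∧ Zs n a b S

def PB (n : ℕ) : Prop := ∀ (ι : Type) [DecidableEq ι] (a b : ι → ℤ) (X : Finset ι),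
  X.card = 3 * n → Zs n a b X → ∃ S ⊆ X, S.card = n ∧ Zs n a b S

theorem kemPrime (p : ℕ) (hp : p.Prime) : Kem p := by
  intro ι _ a b X hX
  have := Fact.mk hp
  obtain ⟨Y, hY, hYc⟩ := Finset.exists_subset_card_eq hX
  suffices ∃ S ⊆ Y, S.card = p ∧ Zs p a b S by
    obtain ⟨S, h1, h2⟩ := this
    exact ⟨S, h1.trans hY, h2⟩
  rcases hp.eq_two_or_odd' with rfl | ho
  · exact kemTwo a b Y hYc
  · exact kemOdd p ho a b Y hYc

/-- Greedy extraction of `k` disjoint blocks of length `m`. -/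
theorem greedy {ι : Type} [DecidableEq ι] (m : ℕ) (hm : 0 < m) (a b : ι → ℤ) (X : Finset ι) (k : ℕ)
    (H : ∀ j < k, ∀ Y ⊆ X, Y.card + j * m = X.card → Zs m a b (X \ Y) → ∃ S ⊆ Y, S.card = m ∧ Zs m a b S) :
    ∃ F : Finset (Finset ι), F.card = k ∧ (∀ S ∈ F, S ⊆ X ∧ S.card = m ∧ Zs m a b S) ∧
      (F : Set (Finset ι)).PairwiseDisjoint id := by
  induction k with
  | zero => exact ⟨∅, by simp⟩
  | succ k ih =>
    obtain ⟨F, h1, h2, h3⟩ := ih (fun j hj => H j (by omega))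
    have hU : F.biUnion id ⊆ X := Finset.biUnion_subset.mpr fun S hS => (h2 S hS).1
    have hc : (F.biUnion id).card = k * m := by
      rw [Finset.card_biUnion h3]
      simp only [id]
      rw [Finset.sum_congr rfl (fun S hS => (h2 S hS).2.1), Finset.sum_const, h1, smul_eq_mul]
    have hle := Finset.card_le_card hU
    obtain ⟨S, hS, hSc, hSz⟩ := H k (by omega) (X \ F.biUnion id) Finset.sdiff_subset
      (by rw [Finset.card_sdiff_of_subset hU]; omega)
      (by
        rw [Finset.sdiff_sdiff_eq_self hU]
        constructor
        · rw [Finset.sum_biUnion h3]; exact Finset.dvd_sum fun S hS => (h2 S hS).2.2.1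
        · rw [Finset.sum_biUnion h3]; exact Finset.dvd_sum fun S hS => (h2 S hS).2.2.2)
    have hdis : ∀ T ∈ F, Disjoint S T := fun T hT =>
      (Finset.subset_sdiff.mp hS).2.mono_right (Finset.subset_biUnion_of_mem id hT)
    have hnot : S ∉ F := fun h => by
      have := hdis S h
      rw [disjoint_self, Finset.bot_eq_empty] at this
      rw [this, Finset.card_empty] at hSc
      omega
    refine ⟨insert S F, by rw [Finset.card_insert_of_notMem hnot, h1], ?_, ?_⟩
    · intro T hT
      rcases Finset.mem_insert.mp hT with rfl | hT
      · exact ⟨hS.trans Finset.sdiff_subset, hSc, hSz⟩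
      · exact h2 T hT
    · rw [Finset.coe_insert]
      exact h3.insert fun T hT _ => hdis T hT

/-- Gluing blocks together. -/
theorem glue {ι : Type} [DecidableEq ι] (m q : ℕ) (a b : ι → ℤ) (X : Finset ι)
    (T : Finset (Finset ι)) (h2 : ∀ S ∈ T, S ⊆ X ∧ S.card = m ∧ Zs m a b S)
    (h3 : (T : Set (Finset ι)).PairwiseDisjoint id)
    (hz : Zs q (fun S => (∑ i ∈ S, a i) / m) (fun S => (∑ i ∈ S, b i) / m) T) :
    T.biUnion id ⊆ X ∧ (T.biUnion id).card = T.card * m ∧ Zs (q * m) a b (T.biUnion id) := by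
  refine ⟨Finset.biUnion_subset.mpr fun S hS => (h2 S hS).1, ?_, ?_, ?_⟩
  · rw [Finset.card_biUnion h3]
    simp only [id]
    rw [Finset.sum_congr rfl (fun S hS => (h2 S hS).2.1), Finset.sum_const, smul_eq_mul]
  · rw [Finset.sum_biUnion h3, Nat.cast_mul]
    have := mul_dvd_mul_right hz.1 (m : ℤ)
    rw [Finset.sum_mul] at this
    simp only [id]
    rwa [Finset.sum_congr rfl (fun S hS => (Int.ediv_mul_cancel (h2 S hS).2.2.1).symm)]
  · rw [Finset.sum_biUnion h3, Nat.cast_mul]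
    have := mul_dvd_mul_right hz.2 (m : ℤ)
    rw [Finset.sum_mul] at this
    simp only [id]
    rwa [Finset.sum_congr rfl (fun S hS => (Int.ediv_mul_cancel (h2 S hS).2.2.2).symm)]

theorem kem (n : ℕ) : Kem n := by
  induction n using induction_on_primes with
  | zero => intro ι _ a b X _; exact ⟨∅, by simp, rfl, Zs.empty⟩
  | one =>
    intro ι _ a b X hX
    obtain ⟨S, h1, h2⟩ := Finset.exists_subset_card_eq (s := X) (n := 1) (by omega)
    exact ⟨S, h1, h2, by simp [Zs]⟩
  | prime_mul p m hp ih =>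
    intro ι _ a b X hX
    rcases Nat.eq_zero_or_pos m with rfl | hm
    · exact ⟨∅, by simp, by simp, Zs.empty⟩
    have hp2 := hp.two_le
    obtain ⟨F, h1, h2, h3⟩ := greedy m hm a b X (4 * p - 3) (by
      intro j hj Y hY hc _
      refine ih ι a b Y ?_
      have : j * m + 4 * m ≤ 4 * (p * m) := by
        calc j * m + 4 * m = (j + 4) * m := by ring
          _ ≤ (4 * p) * m := Nat.mul_le_mul_right _ (by omega)
          _ = _ := by ring
      omega)
    obtain ⟨T, hT, hTc, hTz⟩ := kemPrime p hp (Finset ι) (fun S => (∑ i ∈ S, a i) / m)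
      (fun S => (∑ i ∈ S, b i) / m) F (by omega)
    obtain ⟨g1, g2, g3⟩ := glue m p a b X T (fun S hS => h2 S (hT hS)) (h3.subset hT) hTz
    exact ⟨_, g1, by rw [g2, hTc], g3⟩

theorem blocks {ι : Type} [DecidableEq ι] (m : ℕ) (hm : 0 < m) (hB : PB m) (a b : ι → ℤ) (X : Finset ι)
    (c : ℕ) (hX : X.card = (c + 2) * m) (hz : Zs m a b X) :
    ∃ F : Finset (Finset ι), F.card = c ∧ (∀ S ∈ F, S ⊆ X ∧ S.card = m ∧ Zs m a b S) ∧
      (F : Set (Finset ι)).PairwiseDisjoint id := by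
  refine greedy m hm a b X c ?_
  intro j hj Y hY hc hz'
  have hzY : Zs m a b Y := by
    have := hz.sdiff Finset.sdiff_subset hz'
    rwa [Finset.sdiff_sdiff_eq_self hY] at this
  obtain ⟨r, rfl⟩ : ∃ r, c = j + 1 + r := ⟨c - (j+1), by omega⟩
  have hYc : Y.card = (r + 3) * m := by
    have : (j + 1 + r + 2) * m = (r + 3) * m + j * m := by ring
    omega
  rcases r with _ | r
  · exact hB ι a b Y (by omega) hzY
  · refine kem m ι a b Y ?_
    have : (r + 1 + 3) * m = r * m + 4 * m := by ring
    omega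

theorem Zs.of_dvd {ι : Type} {n m : ℕ} {a b : ι → ℤ} {X : Finset ι}
    (hX : Zs n a b X) (h : m ∣ n) : Zs m a b X :=
  ⟨(Int.natCast_dvd_natCast.mpr h).trans hX.1, (Int.natCast_dvd_natCast.mpr h).trans hX.2⟩

theorem pb (n : ℕ) : PB n := by
  induction n using induction_on_primes with
  | zero => intro ι _ a b X _ _; exact ⟨∅, by simp, rfl, Zs.empty⟩
  | one =>
    intro ι _ a b X hX _
    obtain ⟨S, h1, h2⟩ := Finset.exists_subset_card_eq (s := X) (n := 1) (by omega)
    exact ⟨S, h1, h2, by simp [Zs]⟩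
  | prime_mul p m hp ih =>
    intro ι _ a b X hX hz
    rcases Nat.eq_zero_or_pos m with rfl | hm
    · exact ⟨∅, by simp, by simp, Zs.empty⟩
    have hp2 := hp.two_le
    have := Fact.mk hp
    obtain ⟨F, h1, h2, h3⟩ := blocks m hm ih a b X (3 * p - 2)
      (by rw [hX, Nat.sub_add_cancel (by omega)]; ring) (hz.of_dvd (Dvd.intro_left _ rfl))
    obtain ⟨T, hT, hTc, hTz⟩ := propC p (fun S : Finset ι => (∑ i ∈ S, a i) / m)
      (fun S => (∑ i ∈ S, b i) / m) F h1
    obtain ⟨g1, g2, g3⟩ := glue m p a b X T (fun S hS => h2 S (hT hS)) (h3.subset hT) hTz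
    rcases hTc with hTc | hTc
    · exact ⟨_, g1, by rw [g2, hTc], g3⟩
    · refine ⟨X \ T.biUnion id, Finset.sdiff_subset, ?_, hz.sdiff g1 g3⟩
      rw [Finset.card_sdiff_of_subset g1, g2, hTc, hX, mul_assoc]
      omega

theorem square_upper (n d : ℕ) (hn : 0 < n) (hd : 0 < d) (hdn : d ∣ n)
    (J : Multiset (ZMod n × ZMod n)) (hJ : Multiset.card J = 4 * n - d)
    (hsum : J.sum = 0) :
    ∃ S ≤ J, Multiset.card S = n ∧ S.sum = 0 := by
  have : NeZero n := ⟨hn.ne'⟩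
  let a : (ZMod n × ZMod n) × ℕ → ℤ := fun x => (x.1.1.val : ℤ)
  let b : (ZMod n × ZMod n) × ℕ → ℤ := fun x => (x.1.2.val : ℤ)
  have hZ : ∀ S : Finset ((ZMod n × ZMod n) × ℕ), Zs n a b S ↔ (S.val.map Prod.fst).sum = 0 := by
    intro S
    have e : (S.val.map Prod.fst).sum = ∑ x ∈ S, x.1 := rfl
    rw [e, Prod.ext_iff, Prod.fst_sum, Prod.snd_sum, Zs, ← ZMod.intCast_zmod_eq_zero_iff_dvd,
      ← ZMod.intCast_zmod_eq_zero_iff_dvd]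
    simp [a, b]
  let X := J.toEnumFinset
  have hXm : X.val.map Prod.fst = J := J.map_toEnumFinset_fst
  have hXc : X.card = 4 * n - d := by
    rw [← hJ, ← hXm, Multiset.card_map]; rfl
  have hXz : Zs n a b X := (hZ X).mpr (by rw [hXm, hsum])
  suffices ∃ S ⊆ X, S.card = n ∧ Zs n a b S by
    obtain ⟨S, h1, h2, h3⟩ := this
    refine ⟨S.val.map Prod.fst, ?_, by rw [Multiset.card_map]; exact h2, (hZ S).mp h3⟩
    rw [← hXm]
    exact Multiset.map_le_map (Finset.val_le_iff.mpr h1)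
  clear_value a b X
  obtain ⟨m, hm⟩ := hdn
  have hm0 : 0 < m := Nat.pos_of_ne_zero (by rintro rfl; omega)
  obtain ⟨F, h1, h2, h3⟩ := blocks d hd (pb d) a b X (4 * m - 3)
    (by
      have : (4 * m - 3 + 2) = 4 * m - 1 := by omega
      rw [hXc, this, Nat.sub_mul, hm, one_mul]
      congr 1; ring) (hXz.of_dvd ⟨m, hm⟩)
  obtain ⟨T, hT, hTc, hTz⟩ := kem m _ (fun S => (∑ i ∈ S, a i) / d)
    (fun S => (∑ i ∈ S, b i) / d) F (by omega)
  obtain ⟨g1, g2, g3⟩ := glue d m a b X T (fun S hS => h2 S (hT hS)) (h3.subset hT) hTz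
  have e : n = m * d := by rw [hm, mul_comm]
  exact ⟨_, g1, by rw [g2, hTc, e], g3.of_dvd (Dvd.intro_left 1 (by rw [e, one_mul]))⟩
end

section
/- Let ℓ be the smallest integer with ℓ ≥ 4 and ℓ ∤ n. If J is a zero-sum sequence in (ℤ/nℤ)² of length at least 4n - ℓ + 1, then J contains a zero-sum subsequence of length n. -/
open Finset

theorem aux_cw (p : ℕ) [Fact p.Prime] {σ : Type} [Fintype σ] [DecidableEq σ]
    (v : σ → Fin 3 → ZMod p) (h : 3 * (p - 1) < Fintype.card σ) :
    ∑ T : Finset σ, (-1 : ZMod p) ^ #T * (if ∀ j, ∑ i ∈ T, v i j = 0 then 1 else 0) = 0 := by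
  classical
  have hp : 2 ≤ p := (Fact.out : p.Prime).two_le
  let P : Fin 3 → MvPolynomial σ (ZMod p) := fun j =>
    ∑ i, MvPolynomial.C (v i j) * MvPolynomial.X i ^ (p - 1)
  have hdeg : ∑ j : Fin 3, (P j).totalDegree < Fintype.card σ := by
    refine lt_of_le_of_lt (Finset.sum_le_card_nsmul _ _ (p - 1) ?_) (by simpa using h)
    intro j _
    refine (MvPolynomial.totalDegree_finsetSum _ _).trans (Finset.sup_le fun i _ => ?_)
    refine (MvPolynomial.totalDegree_mul _ _).trans ?_
    simp [MvPolynomial.totalDegree_X_pow]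
  have key := char_dvd_card_solutions_of_fintype_sum_lt p hdeg
  have hev : ∀ (x : σ → ZMod p) (j : Fin 3), MvPolynomial.eval x (P j)
      = ∑ i ∈ univ.filter (fun i => x i ≠ 0), v i j := by
    intro x j
    rw [Finset.sum_filter]
    simp only [P, map_sum, map_mul, map_pow, MvPolynomial.eval_C, MvPolynomial.eval_X]
    refine Finset.sum_congr rfl fun i _ => ?_
    by_cases hx : x i = 0
    · simp [hx, show p - 1 ≠ 0 by omega]
    · simp [hx, ZMod.pow_card_sub_one_eq_one hx]
  rw [← CharP.cast_eq_zero_iff (ZMod p) p, Fintype.card_subtype, Finset.card_filter] at key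
  refine Eq.trans ?_ key
  push_cast
  rw [← Finset.sum_fiberwise (s := (univ : Finset (σ → ZMod p)))
    (g := fun x => univ.filter (fun i => x i ≠ 0))]
  refine Finset.sum_congr rfl fun T _ => ?_
  have hcard : ((univ.filter (fun x : σ → ZMod p => univ.filter (fun i => x i ≠ 0) = T)).card : ZMod p)
      = (-1) ^ #T := by
    have : univ.filter (fun x : σ → ZMod p => univ.filter (fun i => x i ≠ 0) = T)
        = Fintype.piFinset (fun i => if i ∈ T then (univ.erase 0 : Finset (ZMod p)) else {0}) := by
      ext x
      simp only [mem_filter, mem_univ, true_and, Fintype.mem_piFinset, Finset.ext_iff]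
      refine forall_congr' fun i => ?_
      by_cases hi : i ∈ T <;> simp [hi]
    rw [this, Fintype.card_piFinset]
    simp only [apply_ite Finset.card, Finset.card_erase_of_mem (mem_univ _), card_singleton,
      Finset.card_univ, ZMod.card]
    rw [Finset.prod_ite_mem, Finset.univ_inter, Finset.prod_const]
    rw [Nat.cast_pow, Nat.cast_sub (by omega)]
    simp
  refine Eq.trans (b := ∑ x ∈ univ.filter
    (fun x : σ → ZMod p => univ.filter (fun i => x i ≠ 0) = T),
    if ∀ j, ∑ i ∈ T, v i j = 0 then (1 : ZMod p) else 0) ?_ (Finset.sum_congr rfl ?_)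
  · rw [Finset.sum_const, nsmul_eq_mul, hcard]
  · intro x hx
    simp only [mem_filter, mem_univ, true_and] at hx
    simp only [hev, hx]

theorem aux_cw_finset (p : ℕ) [Fact p.Prime] {ι : Type} [DecidableEq ι] (s : Finset ι)
    (v : ι → Fin 3 → ZMod p) (h : 3 * (p - 1) < #s) :
    ∑ T ∈ s.powerset, (-1 : ZMod p) ^ #T * (if ∀ j, ∑ i ∈ T, v i j = 0 then 1 else 0) = 0 := by
  have := aux_cw p (σ := s) (fun i => v i) (by simpa using h)
  refine Eq.trans (Eq.symm ?_) this
  refine Finset.sum_bij (fun T _ => T.map (Function.Embedding.subtype _)) ?_ ?_ ?_ ?_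
  · intro T _
    rw [mem_powerset]
    intro i hi
    simp only [mem_map] at hi
    obtain ⟨a, _, rfl⟩ := hi
    exact a.2
  · intro a _ b _ hab
    exact Finset.map_injective _ hab
  · intro b hb
    rw [mem_powerset] at hb
    refine ⟨b.subtype (· ∈ s), mem_univ _, ?_⟩
    rw [Finset.subtype_map_of_mem]
    exact fun i hi => hb hi
  · intro a _
    simp

theorem aux_alt0 (p : ℕ) [Fact p.Prime] {ι : Type} [DecidableEq ι] (s : Finset ι)
    (f : ι → ZMod p × ZMod p) (h : 3 * (p - 1) < #s) :
    ∑ T ∈ s.powerset, (-1 : ZMod p) ^ #T *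
      (if p ∣ #T then (if ∑ i ∈ T, f i = 0 then 1 else 0) else 0) = 0 := by
  refine Eq.trans ?_ (aux_cw_finset p s (fun i => ![(f i).1, (f i).2, 1]) h)
  refine Finset.sum_congr rfl fun T _ => ?_
  congr 1
  simp only [Fin.forall_fin_succ, Prod.ext_iff, Prod.fst_sum, Prod.snd_sum]
  simp [CharP.cast_eq_zero_iff (ZMod p) p, ← ite_and]
  congr 1
  simp only [eq_iff_iff]
  tauto

theorem aux_alt1 (p : ℕ) [Fact p.Prime] {ι : Type} [DecidableEq ι] (s : Finset ι)
    (f : ι → ZMod p × ZMod p) (h : 3 * (p - 1) ≤ #s) :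
    ∑ T ∈ s.powerset, ((-1 : ZMod p) ^ #T *
      (if p ∣ #T then (if ∑ i ∈ T, f i = 0 then 1 else 0) else 0)
      - (-1 : ZMod p) ^ #T *
      (if p ∣ #T + 1 then (if ∑ i ∈ T, f i = 0 then 1 else 0) else 0)) = 0 := by
  have := aux_alt0 p (insert none (s.map Function.Embedding.some))
    (fun o => o.elim 0 f) (by rw [card_insert_of_notMem (by simp)]; simpa using Nat.lt_succ_of_le h)
  rw [Finset.sum_powerset_insert (by simp), ← Finset.sum_add_distrib] at this
  refine Eq.trans ?_ this
  refine Finset.sum_bij (fun T _ => T.map Function.Embedding.some) ?_ ?_ ?_ ?_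
  · intro T hT
    simpa using hT
  · intro a _ b _ hab
    exact Finset.map_injective _ hab
  · intro b hb
    rw [mem_powerset, Finset.subset_map_iff] at hb
    obtain ⟨t, ht, rfl⟩ := hb
    exact ⟨t, by simpa using ht, rfl⟩
  · intro T hT
    rw [card_insert_of_notMem (by simp), Finset.sum_insert (by simp)]
    simp [pow_succ]
    split_ifs <;> ring

theorem aux_D (p : ℕ) [Fact p.Prime] {ι : Type} [DecidableEq ι] (s : Finset ι)
    (f : ι → ZMod p × ZMod p) (h : #s = 3 * p - 2) :
    ∃ T ⊆ s, (#T = p ∨ #T = 2 * p) ∧ ∑ i ∈ T, f i = 0 := by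
  have hp : 2 ≤ p := (Fact.out : p.Prime).two_le
  by_contra! hcon
  have h0 := aux_alt0 p s f (by omega)
  rw [Finset.sum_eq_single ∅] at h0
  · simp at h0
  · intro T hT hne
    rw [mem_powerset] at hT
    have hc := card_le_card hT
    have hpos := Finset.card_pos.mpr (nonempty_iff_ne_empty.mpr hne)
    by_cases hd : p ∣ #T
    · obtain ⟨k, hk⟩ := hd
      have : k < 3 := by
        by_contra hk3
        have : p * 3 ≤ p * k := Nat.mul_le_mul_left _ (by omega)
        omega
      have hor : #T = p ∨ #T = 2 * p := by
        interval_cases k <;> omega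
      simp [hcon T hT hor]
    · simp [hd]
  · simp

theorem aux_sum_range_dvd {M : Type} [AddCommMonoid M] (p : ℕ) (hp : 0 < p) (g : ℕ → M) (m : ℕ) :
    ∑ k ∈ range (m * p), (if p ∣ k then g k else 0) = ∑ j ∈ range m, g (j * p) := by
  induction m with
  | zero => simp
  | succ m ih =>
    rw [Nat.succ_mul, Finset.sum_range_add, ih, Finset.sum_range_succ]
    congr 1
    rw [Finset.sum_eq_single 0]
    · simp
    · intro b hb hb0
      rw [mem_range] at hb
      rw [if_neg]
      rw [Nat.dvd_add_right (Dvd.intro_left m rfl)]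
      exact Nat.not_dvd_of_pos_of_lt (by omega) hb
    · simp; omega

theorem aux_sum_range_dvd_succ {M : Type} [AddCommMonoid M] (p : ℕ) (hp : 0 < p) (g : ℕ → M) (m : ℕ) :
    ∑ k ∈ range (m * p), (if p ∣ k + 1 then g k else 0) = ∑ j ∈ range m, g (j * p + (p - 1)) := by
  induction m with
  | zero => simp
  | succ m ih =>
    rw [Nat.succ_mul, Finset.sum_range_add, ih, Finset.sum_range_succ]
    congr 1
    rw [Finset.sum_eq_single (p - 1)]
    · rw [if_pos]
      rw [show m * p + (p - 1) + 1 = (m + 1) * p by rw [Nat.succ_mul]; omega]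
      exact Dvd.intro_left _ rfl
    · intro b hb hb0
      rw [mem_range] at hb
      rw [if_neg]
      rw [add_assoc, Nat.dvd_add_right (Dvd.intro_left m rfl)]
      exact Nat.not_dvd_of_pos_of_lt (by omega) (by omega)
    · simp; omega

/-- number of zero-sum subsets of size `k`, modulo `p` -/
def auxCnt (p : ℕ) {ι : Type} (f : ι → ZMod p × ZMod p) (k : ℕ) (s : Finset ι) : ZMod p :=
  ∑ T ∈ s.powersetCard k, if ∑ i ∈ T, f i = 0 then 1 else 0

theorem auxCnt_zero (p : ℕ) {ι : Type} (f : ι → ZMod p × ZMod p) (s : Finset ι) :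
    auxCnt p f 0 s = 1 := by
  rw [auxCnt, powersetCard_zero, Finset.sum_singleton]
  simp

theorem auxCnt_gt (p : ℕ) {ι : Type} (f : ι → ZMod p × ZMod p) (k : ℕ) (s : Finset ι)
    (h : #s < k) : auxCnt p f k s = 0 := by
  simp [auxCnt, powersetCard_eq_empty.mpr h]

theorem aux_sum_pow (p : ℕ) {ι : Type} (f : ι → ZMod p × ZMod p) (s : Finset ι)
    (Q : ℕ → Prop) [DecidablePred Q] (N : ℕ) (hN : #s < N) :
    ∑ T ∈ s.powerset, ((-1 : ZMod p) ^ #T *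
      (if Q #T then (if ∑ i ∈ T, f i = 0 then 1 else 0) else 0)) =
    ∑ k ∈ range N, (if Q k then (-1 : ZMod p) ^ k * auxCnt p f k s else 0) := by
  rw [Finset.sum_powerset]
  rw [Finset.sum_subset (s₂ := range N) (by intro x; simp; omega)]
  · refine Finset.sum_congr rfl fun k _ => ?_
    rw [auxCnt]
    split_ifs with hq
    · rw [Finset.mul_sum]
      refine Finset.sum_congr rfl fun T hT => ?_
      rw [mem_powersetCard] at hT
      simp [hT.2, hq]
    · refine Finset.sum_eq_zero fun T hT => ?_
      rw [mem_powersetCard] at hT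
      simp [hT.2, hq]
  · intro k _ hk
    rw [powersetCard_eq_empty.mpr (by simpa using hk), Finset.sum_empty]

theorem aux_E1 (p : ℕ) [Fact p.Prime] (hodd : Odd p) {ι : Type} [DecidableEq ι] (s : Finset ι)
    (f : ι → ZMod p × ZMod p) (h : 3 * (p - 1) < #s) (h' : #s < 4 * p) :
    1 - auxCnt p f p s + auxCnt p f (2 * p) s - auxCnt p f (3 * p) s = 0 := by
  have hp : 2 ≤ p := (Fact.out : p.Prime).two_le
  have h0 := aux_alt0 p s f h
  rw [aux_sum_pow p f s _ _ h', aux_sum_range_dvd p (by omega)] at h0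
  simp only [Finset.sum_range_succ, Finset.sum_range_zero] at h0
  simp only [zero_mul, one_mul, auxCnt_zero, pow_zero, pow_mul', hodd.neg_one_pow] at h0
  linear_combination h0

theorem aux_E2 (p : ℕ) [Fact p.Prime] (hodd : Odd p) {ι : Type} [DecidableEq ι] (s : Finset ι)
    (f : ι → ZMod p × ZMod p) (h : 3 * (p - 1) ≤ #s) (h' : #s < 4 * p - 1) :
    1 - auxCnt p f p s + auxCnt p f (2 * p) s - auxCnt p f (3 * p) s
     - auxCnt p f (p - 1) s + auxCnt p f (2 * p - 1) s - auxCnt p f (3 * p - 1) s = 0 := by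
  have hp : 2 ≤ p := (Fact.out : p.Prime).two_le
  have h0 := aux_alt1 p s f h
  rw [Finset.sum_sub_distrib, aux_sum_pow p f s (fun k => p ∣ k) (4 * p) (by omega),
    aux_sum_pow p f s (fun k => p ∣ k + 1) (4 * p) (by omega), aux_sum_range_dvd p (by omega),
    aux_sum_range_dvd_succ p (by omega)] at h0
  simp only [Finset.sum_range_succ, Finset.sum_range_zero] at h0
  have hev : Even (p - 1) := by
    obtain ⟨k, hk⟩ := hodd
    exact ⟨k, by omega⟩
  rw [show 1 * p + (p - 1) = 2 * p - 1 by omega, show 2 * p + (p - 1) = 3 * p - 1 by omega,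
    auxCnt_gt p f (3 * p + (p - 1)) s (by omega)] at h0
  have e2 : (-1 : ZMod p) ^ (2 * p - 1) = -1 := by
    apply Odd.neg_one_pow
    exact ⟨p - 1, by omega⟩
  have e3 : (-1 : ZMod p) ^ (3 * p - 1) = 1 := by
    apply Even.neg_one_pow
    obtain ⟨k, hk⟩ := hodd
    exact ⟨3 * k + 1, by omega⟩
  simp only [zero_mul, one_mul, auxCnt_zero, pow_zero, pow_mul', hodd.neg_one_pow, zero_add,
    hev.neg_one_pow, e2, e3] at h0
  linear_combination h0

theorem aux_superset_card {ι : Type} [DecidableEq ι] (s T : Finset ι) (hT : T ⊆ s) (m : ℕ)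
    (hm : #T ≤ m) :
    #((s.powersetCard m).filter (fun S => T ⊆ S)) = (#s - #T).choose (m - #T) := by
  rw [← card_sdiff_of_subset hT, ← card_powersetCard]
  symm
  refine Finset.card_bij' (fun U _ => U ∪ T) (fun S _ => S \ T) ?_ ?_ ?_ ?_
  · intro U hU
    rw [mem_powersetCard] at hU
    have hd : Disjoint U T := (disjoint_sdiff.mono_right hU.1).symm
    rw [mem_filter, mem_powersetCard, card_union_of_disjoint hd]
    exact ⟨⟨union_subset (hU.1.trans sdiff_subset) hT, by omega⟩, subset_union_right⟩
  · intro S hS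
    rw [mem_filter, mem_powersetCard] at hS
    rw [mem_powersetCard, card_sdiff_of_subset hS.2]
    exact ⟨sdiff_subset_sdiff hS.1.1 (Subset.refl _), by omega⟩
  · intro U hU
    rw [mem_powersetCard] at hU
    have hd : Disjoint U T := (disjoint_sdiff.mono_right hU.1).symm
    exact union_sdiff_cancel_right hd
  · intro S hS
    rw [mem_filter, mem_powersetCard] at hS
    exact sdiff_union_of_subset hS.2

theorem aux_superset (p : ℕ) {ι : Type} [DecidableEq ι] (f : ι → ZMod p × ZMod p) (s : Finset ι)
    (m k : ℕ) (hk : k ≤ m) :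
    ∑ S ∈ s.powersetCard m, auxCnt p f k S = ((#s - k).choose (m - k) : ℕ) * auxCnt p f k s := by
  unfold auxCnt
  rw [Finset.sum_comm' (t' := s.powersetCard k)
    (s' := fun T => (s.powersetCard m).filter (fun S => T ⊆ S)), Finset.mul_sum]
  · refine Finset.sum_congr rfl fun T hT => ?_
    rw [mem_powersetCard] at hT
    rw [Finset.sum_const, nsmul_eq_mul, aux_superset_card s T hT.1 m (by omega), hT.2]
  · intro S T
    simp only [mem_powersetCard, mem_filter]
    constructor
    · rintro ⟨⟨h1, h2⟩, h3, h4⟩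
      exact ⟨⟨⟨h1, h2⟩, h3⟩, h3.trans h1, h4⟩
    · rintro ⟨⟨⟨h1, h2⟩, h3⟩, _, h4⟩
      exact ⟨⟨h1, h2⟩, h3, h4⟩

theorem aux_pairs (p : ℕ) {ι : Type} [DecidableEq ι] (f : ι → ZMod p × ZMod p) (s : Finset ι)
    (a c : ℕ) :
    ∑ A ∈ s.powersetCard a, (if ∑ i ∈ A, f i = 0 then auxCnt p f c (s \ A) else 0)
    = ∑ D ∈ s.powersetCard (a + c), (if ∑ i ∈ D, f i = 0 then auxCnt p f c D else 0) := by
  have h1 : ∀ A : Finset ι, (if ∑ i ∈ A, f i = 0 then auxCnt p f c (s \ A) else 0)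
      = ∑ C ∈ (s \ A).powersetCard c,
        (if ∑ i ∈ A, f i = 0 ∧ ∑ i ∈ C, f i = 0 then (1 : ZMod p) else 0) := by
    intro A
    unfold auxCnt
    split_ifs with h <;> simp [h]
  have h2 : ∀ A : Finset ι, (if ∑ i ∈ A, f i = 0 then auxCnt p f c A else 0)
      = ∑ C ∈ A.powersetCard c,
        (if ∑ i ∈ A, f i = 0 ∧ ∑ i ∈ C, f i = 0 then (1 : ZMod p) else 0) := by
    intro A
    unfold auxCnt
    split_ifs with h <;> simp [h]
  simp only [h1, h2]
  rw [Finset.sum_sigma', Finset.sum_sigma']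
  have hdisj : ∀ A C : Finset ι, C ⊆ s \ A → Disjoint A C :=
    fun A C h => disjoint_sdiff.mono_right h
  refine Finset.sum_bij' (fun x _ => ⟨x.1 ∪ x.2, x.2⟩) (fun x _ => ⟨x.1 \ x.2, x.2⟩) ?_ ?_ ?_ ?_ ?_
  · rintro ⟨A, C⟩ h
    simp only [mem_sigma, mem_powersetCard] at h ⊢
    refine ⟨⟨union_subset h.1.1 (h.2.1.trans sdiff_subset), ?_⟩, subset_union_right, h.2.2⟩
    rw [card_union_of_disjoint (hdisj _ _ h.2.1)]
    omega
  · rintro ⟨D, C⟩ h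
    simp only [mem_sigma, mem_powersetCard] at h ⊢
    refine ⟨⟨sdiff_subset.trans h.1.1, ?_⟩, ?_, h.2.2⟩
    · rw [card_sdiff_of_subset h.2.1]
      omega
    · intro i hi
      simp only [mem_sdiff]
      exact ⟨h.1.1 (h.2.1 hi), fun hh => hh.2 hi⟩
  · rintro ⟨A, C⟩ h
    simp only [mem_sigma, mem_powersetCard] at h
    simp only [union_sdiff_cancel_right (hdisj _ _ h.2.1)]
  · rintro ⟨D, C⟩ h
    simp only [mem_sigma, mem_powersetCard] at h
    simp only [sdiff_union_of_subset h.2.1]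
  · rintro ⟨A, C⟩ h
    simp only [mem_sigma, mem_powersetCard] at h
    simp only [sum_union (hdisj _ _ h.2.1)]
    refine if_congr ?_ rfl rfl
    constructor
    · rintro ⟨h1, h2⟩
      simp [h1, h2]
    · rintro ⟨h1, h2⟩
      rw [h2] at h1
      exact ⟨by simpa using h1, h2⟩

theorem aux_choose (p : ℕ) [Fact p.Prime] (N m : ℕ) (hm : m + p = N) :
    ((N.choose m : ℕ) : ZMod p) = ((N / p : ℕ) : ZMod p) := by
  have hp : 2 ≤ p := (Fact.out : p.Prime).two_le
  rw [Nat.choose_symm_of_eq_add hm.symm, ZMod.natCast_eq_natCast_iff]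
  refine Choose.choose_modEq_choose_mod_mul_choose_div_nat.trans ?_
  rw [Nat.mod_self, Nat.div_self (by omega)]
  simp
  rfl

theorem aux_reiher_odd (p : ℕ) [Fact p.Prime] (hodd : Odd p) {ι : Type} [DecidableEq ι]
    (s : Finset ι) (f : ι → ZMod p × ZMod p) (hs : #s = 4 * p - 3) :
    ∃ T ⊆ s, #T = p ∧ ∑ i ∈ T, f i = 0 := by
  have hp2 : 2 ≤ p := (Fact.out : p.Prime).two_le
  have hp : 3 ≤ p := by
    obtain ⟨k, hk⟩ := hodd
    omega
  by_contra! hcon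
  have c0 : ∀ S ⊆ s, auxCnt p f p S = 0 := by
    intro S hS
    refine Finset.sum_eq_zero fun T hT => ?_
    rw [mem_powersetCard] at hT
    rw [if_neg (hcon T (hT.1.trans hS) hT.2)]
  have c3 : ∀ S ⊆ s, auxCnt p f (3 * p) S = 0 := by
    intro S hS
    refine Finset.sum_eq_zero fun D hD => ?_
    rw [mem_powersetCard] at hD
    rw [if_neg]
    intro hsum
    obtain ⟨E, hE, hEc⟩ := Finset.exists_subset_card_eq (s := D) (n := 3 * p - 2) (by omega)
    obtain ⟨T, hT, hTc | hTc, hT0⟩ := aux_D p E f hEc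
    · exact hcon T (hT.trans (hE.trans (hD.1.trans hS))) hTc hT0
    · have hTD := hT.trans hE
      refine hcon (D \ T) (sdiff_subset.trans (hD.1.trans hS)) ?_ ?_
      · rw [card_sdiff_of_subset hTD]
        omega
      · have := Finset.sum_sdiff (f := f) hTD
        rw [hT0, hsum] at this
        simpa using this
  have c2 : ∀ S ⊆ s, 3 * (p - 1) < #S → auxCnt p f (2 * p) S = -1 := by
    intro S hS hc
    have := card_le_card hS
    have e := aux_E1 p hodd S f hc (by omega)
    rw [c0 S hS, c3 S hS] at e
    linear_combination e
  -- the relation between sizes `p - 1` and `3 p - 1`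
  have r1 : auxCnt p f (p - 1) s = auxCnt p f (3 * p - 1) s := by
    have := aux_pairs p f s (p - 1) (2 * p)
    rw [show p - 1 + 2 * p = 3 * p - 1 by omega] at this
    have e1 : ∑ A ∈ s.powersetCard (p - 1),
        (if ∑ i ∈ A, f i = 0 then auxCnt p f (2 * p) (s \ A) else 0)
        = - auxCnt p f (p - 1) s := by
      rw [auxCnt, ← Finset.sum_neg_distrib]
      refine Finset.sum_congr rfl fun A hA => ?_
      rw [mem_powersetCard] at hA
      rw [c2 (s \ A) sdiff_subset (by rw [card_sdiff_of_subset hA.1]; omega)]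
      split_ifs <;> simp
    have e2 : ∑ A ∈ s.powersetCard (3 * p - 1),
        (if ∑ i ∈ A, f i = 0 then auxCnt p f (2 * p) A else 0)
        = - auxCnt p f (3 * p - 1) s := by
      rw [auxCnt, ← Finset.sum_neg_distrib]
      refine Finset.sum_congr rfl fun A hA => ?_
      rw [mem_powersetCard] at hA
      rw [c2 A hA.1 (by omega)]
      split_ifs <;> simp
    rw [e1, e2] at this
    exact neg_injective this
  have r2 := aux_E2 p hodd s f (by omega) (by omega)
  have r3 : ∑ S ∈ s.powersetCard (3 * p - 3), (1 - auxCnt p f p S + auxCnt p f (2 * p) S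
      - auxCnt p f (p - 1) S + auxCnt p f (2 * p - 1) S) = 0 := by
    refine Finset.sum_eq_zero fun S hS => ?_
    rw [mem_powersetCard] at hS
    have e := aux_E2 p hodd S f (by omega) (by omega)
    rw [auxCnt_gt p f (3 * p) S (by omega), auxCnt_gt p f (3 * p - 1) S (by omega)] at e
    linear_combination e
  have d3 : (4 * p - 3) / p = 3 := Nat.div_eq_of_lt_le (by omega) (by omega)
  have d2 : (4 * p - 3 - (p - 1)) / p = 2 := Nat.div_eq_of_lt_le (by omega) (by omega)
  have d2' : (4 * p - 3 - p) / p = 2 := Nat.div_eq_of_lt_le (by omega) (by omega)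
  have d1 : (4 * p - 3 - (2 * p - 1)) / p = 1 := Nat.div_eq_of_lt_le (by omega) (by omega)
  have d1' : (4 * p - 3 - (2 * p)) / p = 1 := Nat.div_eq_of_lt_le (by omega) (by omega)
  simp only [Finset.sum_add_distrib, Finset.sum_sub_distrib] at r3
  rw [Finset.sum_const, card_powersetCard, aux_superset p f s _ _ (by omega),
    aux_superset p f s _ _ (by omega), aux_superset p f s _ _ (by omega),
    aux_superset p f s _ _ (by omega), hs, nsmul_eq_mul,
    aux_choose p _ _ (by omega), aux_choose p _ _ (by omega), aux_choose p _ _ (by omega),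
    aux_choose p _ _ (by omega), aux_choose p _ _ (by omega), d3, d2, d2', d1, d1'] at r3
  rw [c0 s (Subset.refl _), c3 s (Subset.refl _), c2 s (Subset.refl _) (by omega)] at r2
  rw [c0 s (Subset.refl _), c2 s (Subset.refl _) (by omega)] at r3
  have h2 : ((2 : ℕ) : ZMod p) = 0 := by
    push_cast at r3 ⊢
    linear_combination r3 - r2 + r1
  rw [CharP.cast_eq_zero_iff (ZMod p) p] at h2
  have := Nat.le_of_dvd (by omega) h2
  omega

theorem aux_reiher (p : ℕ) [Fact p.Prime] {ι : Type} [DecidableEq ι]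
    (s : Finset ι) (f : ι → ZMod p × ZMod p) (hs : #s = 4 * p - 3) :
    ∃ T ⊆ s, #T = p ∧ ∑ i ∈ T, f i = 0 := by
  rcases (Fact.out : p.Prime).eq_two_or_odd' with rfl | hodd
  · obtain ⟨x, hx, y, hy, hne, hxy⟩ := Finset.exists_ne_map_eq_of_card_lt_of_maps_to
      (s := s) (t := (univ : Finset (ZMod 2 × ZMod 2))) (f := f)
      (by rw [hs, Finset.card_univ, Fintype.card_prod, ZMod.card]; norm_num) (by intro x _; simp)
    refine ⟨{x, y}, by intro i; simp; rintro (rfl | rfl) <;> assumption, card_pair hne, ?_⟩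
    rw [sum_pair hne, hxy]
    ext <;> simp [CharTwo.add_self_eq_zero]
  · exact aux_reiher_odd p hodd s f hs

/-- zero sum modulo `n` for a pair of integer functions -/
def auxZ (n : ℕ) {ι : Type} (x y : ι → ℤ) (T : Finset ι) : Prop :=
  (n : ℤ) ∣ ∑ i ∈ T, x i ∧ (n : ℤ) ∣ ∑ i ∈ T, y i

/-- Kemnitz property -/
def auxK (n : ℕ) : Prop := ∀ (ι : Type) [DecidableEq ι] (s : Finset ι) (x y : ι → ℤ),
  4 * n - 3 ≤ #s → ∃ T ⊆ s, #T = n ∧ auxZ n x y T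

/-- zero-sum sequences of length `3n` -/
def auxL (n : ℕ) : Prop := ∀ (ι : Type) [DecidableEq ι] (s : Finset ι) (x y : ι → ℤ),
  #s = 3 * n → auxZ n x y s → ∃ T ⊆ s, #T = n ∧ auxZ n x y T

theorem auxZ_iff (n : ℕ) {ι : Type} (x y : ι → ℤ) (T : Finset ι) :
    auxZ n x y T ↔ ∑ i ∈ T, ((x i : ZMod n), (y i : ZMod n)) = 0 := by
  rw [Prod.ext_iff, Prod.fst_sum, Prod.snd_sum]
  simp only [Prod.fst_zero, Prod.snd_zero]
  rw [← Int.cast_sum, ← Int.cast_sum, ZMod.intCast_zmod_eq_zero_iff_dvd,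
    ZMod.intCast_zmod_eq_zero_iff_dvd, auxZ]

theorem auxK_prime (p : ℕ) (hp : p.Prime) : auxK p := by
  intro ι _ s x y hs
  have : Fact p.Prime := ⟨hp⟩
  obtain ⟨E, hE, hEc⟩ := Finset.exists_subset_card_eq hs
  obtain ⟨T, hT, hTc, h0⟩ := aux_reiher p E (fun i => ((x i : ZMod p), (y i : ZMod p))) hEc
  exact ⟨T, hT.trans hE, hTc, (auxZ_iff _ _ _ _).2 h0⟩

theorem aux_D' (p : ℕ) (hp : p.Prime) {ι : Type} [DecidableEq ι] (s : Finset ι)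
    (x y : ι → ℤ) (h : #s = 3 * p - 2) :
    ∃ T ⊆ s, (#T = p ∨ #T = 2 * p) ∧ auxZ p x y T := by
  have : Fact p.Prime := ⟨hp⟩
  obtain ⟨T, hT, hTc, h0⟩ := aux_D p s (fun i => ((x i : ZMod p), (y i : ZMod p))) h
  exact ⟨T, hT, hTc, (auxZ_iff _ _ _ _).2 h0⟩

theorem auxZ_sdiff (n : ℕ) {ι : Type} [DecidableEq ι] (x y : ι → ℤ) (S T : Finset ι) (h : T ⊆ S)
    (hS : auxZ n x y S) (hT : auxZ n x y T) : auxZ n x y (S \ T) := by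
  rw [auxZ_iff] at *
  have := Finset.sum_sdiff (f := fun i => ((x i : ZMod n), (y i : ZMod n))) h
  rw [hS, hT] at this
  simpa using this

/-- a family of `m` disjoint blocks of length `a`, each with zero sum modulo `a` -/
structure AuxBlocks (a m : ℕ) {ι : Type} [DecidableEq ι] (s : Finset ι) (x y : ι → ℤ)
    (B : Finset (Finset ι)) : Prop where
  card : #B = m
  sub : ∀ b ∈ B, b ⊆ s
  size : ∀ b ∈ B, #b = a
  zero : ∀ b ∈ B, auxZ a x y b
  disj : (B : Set (Finset ι)).PairwiseDisjoint id

theorem AuxBlocks.union_card {a m : ℕ} {ι : Type} [DecidableEq ι] {s : Finset ι} {x y : ι → ℤ}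
    {B : Finset (Finset ι)} (h : AuxBlocks a m s x y B) (C : Finset (Finset ι)) (hC : C ⊆ B) :
    #(C.biUnion id) = #C * a := by
  rw [Finset.card_biUnion (fun b hb c hc hne => h.disj (hC hb) (hC hc) hne)]
  simp only [id]
  rw [Finset.sum_congr rfl (fun b hb => h.size b (hC hb))]
  simp

theorem AuxBlocks.union_sub {a m : ℕ} {ι : Type} [DecidableEq ι] {s : Finset ι} {x y : ι → ℤ}
    {B : Finset (Finset ι)} (h : AuxBlocks a m s x y B) (C : Finset (Finset ι)) (hC : C ⊆ B) :
    C.biUnion id ⊆ s := by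
  rw [Finset.biUnion_subset]
  exact fun b hb => h.sub b (hC hb)

theorem AuxBlocks.union_zero {a m b : ℕ} {ι : Type} [DecidableEq ι] {s : Finset ι} {x y : ι → ℤ}
    {B : Finset (Finset ι)} (h : AuxBlocks a m s x y B) (C : Finset (Finset ι)) (hC : C ⊆ B)
    (hz : auxZ b (fun b => (∑ i ∈ b, x i) / a) (fun b => (∑ i ∈ b, y i) / a) C) :
    auxZ (a * b) x y (C.biUnion id) := by
  unfold auxZ at hz ⊢
  have hd : (C : Set (Finset ι)).PairwiseDisjoint id := fun b hb c hc hne =>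
    h.disj (hC hb) (hC hc) hne
  rw [Finset.sum_biUnion hd, Finset.sum_biUnion hd]
  have ex : ∑ c ∈ C, ∑ i ∈ id c, x i = a * ∑ c ∈ C, (∑ i ∈ c, x i) / (a : ℤ) := by
    rw [Finset.mul_sum]
    exact Finset.sum_congr rfl fun c hc => (Int.mul_ediv_cancel' (h.zero c (hC hc)).1).symm
  have ey : ∑ c ∈ C, ∑ i ∈ id c, y i = a * ∑ c ∈ C, (∑ i ∈ c, y i) / (a : ℤ) := by
    rw [Finset.mul_sum]
    exact Finset.sum_congr rfl fun c hc => (Int.mul_ediv_cancel' (h.zero c (hC hc)).2).symm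
  rw [ex, ey]
  push_cast
  exact ⟨mul_dvd_mul_left _ hz.1, mul_dvd_mul_left _ hz.2⟩

theorem AuxBlocks.all_zero {a m : ℕ} {ι : Type} [DecidableEq ι] {s : Finset ι} {x y : ι → ℤ}
    {B : Finset (Finset ι)} (h : AuxBlocks a m s x y B) : auxZ a x y (B.biUnion id) := by
  have := h.union_zero (b := 1) B (Subset.refl _) (by simp [auxZ])
  simpa using this

theorem AuxBlocks.rest_card {a m : ℕ} {ι : Type} [DecidableEq ι] {s : Finset ι} {x y : ι → ℤ}
    {B : Finset (Finset ι)} (h : AuxBlocks a m s x y B) : #(s \ B.biUnion id) = #s - m * a := by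
  rw [card_sdiff_of_subset (h.union_sub B (Subset.refl _)), h.union_card B (Subset.refl _), h.card]

theorem AuxBlocks.insert {a m : ℕ} (ha : 0 < a) {ι : Type} [DecidableEq ι] {s : Finset ι}
    {x y : ι → ℤ} {B : Finset (Finset ι)} (h : AuxBlocks a m s x y B) (T : Finset ι)
    (hT : T ⊆ s \ B.biUnion id) (hTc : #T = a) (hz : auxZ a x y T) :
    AuxBlocks a (m + 1) s x y (insert T B) := by
  have hd : ∀ b ∈ B, Disjoint T b := by
    intro b hb
    refine (disjoint_sdiff.mono (?_ : b ⊆ B.biUnion id) hT).symm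
    exact Finset.subset_biUnion_of_mem id hb
  have hn : T ∉ B := by
    intro hTB
    have := hd T hTB
    rw [disjoint_self] at this
    simp at this
    subst this
    simp at hTc
    omega
  refine ⟨by rw [card_insert_of_notMem hn, h.card], ?_, ?_, ?_, ?_⟩
  · rintro b hb
    rcases mem_insert.1 hb with rfl | hb
    · exact hT.trans sdiff_subset
    · exact h.sub b hb
  · rintro b hb
    rcases mem_insert.1 hb with rfl | hb
    · exact hTc
    · exact h.size b hb
  · rintro b hb
    rcases mem_insert.1 hb with rfl | hb
    · exact hz
    · exact h.zero b hb
  · rw [coe_insert]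
    exact h.disj.insert fun b hb _ => hd b hb

theorem aux_exists_blocks (a : ℕ) (ha : 0 < a) (hK : auxK a) {ι : Type} [DecidableEq ι]
    (s : Finset ι) (x y : ι → ℤ) (m : ℕ) (hm : m * a + 3 * a - 3 ≤ #s) :
    ∃ B, AuxBlocks a m s x y B := by
  induction m with
  | zero => exact ⟨∅, by simp, by simp, by simp, by simp, by simp⟩
  | succ m ih =>
    rw [Nat.succ_mul] at hm
    obtain ⟨B, hB⟩ := ih (by omega)
    obtain ⟨T, hT, hTc, hz⟩ := hK ι (s \ B.biUnion id) x y (by rw [hB.rest_card]; omega)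
    exact ⟨_, hB.insert ha T hT hTc hz⟩

theorem aux_combine (a b m : ℕ) (hK : auxK b) {ι : Type} [DecidableEq ι]
    (s : Finset ι) (x y : ι → ℤ) (B : Finset (Finset ι)) (hB : AuxBlocks a m s x y B)
    (hm : 4 * b - 3 ≤ m) : ∃ T ⊆ s, #T = a * b ∧ auxZ (a * b) x y T := by
  obtain ⟨C, hC, hCc, hz⟩ := hK (Finset ι) B (fun b => (∑ i ∈ b, x i) / a)
    (fun b => (∑ i ∈ b, y i) / a) (by rw [hB.card]; exact hm)
  exact ⟨C.biUnion id, hB.union_sub C hC, by rw [hB.union_card C hC, hCc, mul_comm],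
    hB.union_zero C hC hz⟩

theorem auxK_mul (a b : ℕ) (ha : 0 < a) (hb : 0 < b) (hKa : auxK a) (hKb : auxK b) :
    auxK (a * b) := by
  intro ι _ s x y hs
  have hab : (4 * b - 3) * a + 3 * a = 4 * (a * b) := by
    obtain ⟨c, rfl⟩ : ∃ c, b = c + 1 := ⟨b - 1, by omega⟩
    rw [show 4 * (c + 1) - 3 = 4 * c + 1 by omega]
    ring
  obtain ⟨B, hB⟩ := aux_exists_blocks a ha hKa s x y (4 * b - 3) (by omega)
  exact aux_combine a b _ hKb s x y B hB le_rfl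

theorem auxK_one : auxK 1 := by
  intro ι _ s x y hs
  obtain ⟨T, hT, hTc⟩ := Finset.exists_subset_card_eq (s := s) (n := 1) (by omega)
  exact ⟨T, hT, hTc, by simp [auxZ]⟩

theorem auxL_one : auxL 1 := by
  intro ι _ s x y hs _
  obtain ⟨T, hT, hTc⟩ := Finset.exists_subset_card_eq (s := s) (n := 1) (by omega)
  exact ⟨T, hT, hTc, by simp [auxZ]⟩

theorem auxK_all (n : ℕ) (hn : 0 < n) : auxK n := by
  induction n using Nat.recOnMul with
  | zero => omega
  | one => exact auxK_one
  | prime p hp => exact auxK_prime p hp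
  | mul a b iha ihb =>
    have ha : 0 < a := Nat.pos_of_mul_pos_right hn
    have hb : 0 < b := Nat.pos_of_mul_pos_left hn
    exact auxK_mul a b ha hb (iha ha) (ihb hb)

/-- leftover step: a block of length `a` more when the rest is zero-sum of length `3a` -/
theorem aux_extra (a m : ℕ) (ha : 0 < a) (hL : auxL a) {ι : Type} [DecidableEq ι]
    (s : Finset ι) (x y : ι → ℤ) (hs : #s = m * a + 3 * a) (hz : auxZ a x y s) :
    ∃ B, AuxBlocks a (m + 1) s x y B := by
  obtain ⟨B, hB⟩ := aux_exists_blocks a ha (auxK_all a ha) s x y m (by omega)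
  obtain ⟨T, hT, hTc, hTz⟩ := hL ι (s \ B.biUnion id) x y (by rw [hB.rest_card]; omega)
    (auxZ_sdiff _ _ _ _ _ (hB.union_sub B (Subset.refl _)) hz hB.all_zero)
  exact ⟨_, hB.insert ha T hT hTc hTz⟩

theorem auxZ_of_dvd {a n : ℕ} (h : a ∣ n) {ι : Type} {x y : ι → ℤ} {s : Finset ι}
    (hz : auxZ n x y s) : auxZ a x y s :=
  ⟨(Int.natCast_dvd_natCast.2 h).trans hz.1, (Int.natCast_dvd_natCast.2 h).trans hz.2⟩

theorem auxL_step (p a : ℕ) (hp : p.Prime) (ha : 0 < a) (hL : auxL a) : auxL (a * p) := by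
  intro ι _ s x y hs hz
  have hp2 := hp.two_le
  have e : (3 * p - 3) * a + 3 * a = 3 * (a * p) := by
    obtain ⟨c, rfl⟩ : ∃ c, p = c + 1 := ⟨p - 1, by omega⟩
    rw [show 3 * (c + 1) - 3 = 3 * c by omega]
    ring
  obtain ⟨B, hB⟩ := aux_extra a (3 * p - 3) ha hL s x y (by omega) (auxZ_of_dvd ⟨p, rfl⟩ hz)
  obtain ⟨C, hC, hCc, hCz⟩ := aux_D' p hp B (fun b => (∑ i ∈ b, x i) / a)
    (fun b => (∑ i ∈ b, y i) / a) (by rw [hB.card]; omega)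
  have hsub := hB.union_sub C hC
  have hzero := hB.union_zero C hC hCz
  have hcard := hB.union_card C hC
  rcases hCc with hc | hc
  · exact ⟨_, hsub, by rw [hcard, hc, mul_comm], hzero⟩
  · refine ⟨s \ C.biUnion id, sdiff_subset, ?_, auxZ_sdiff _ _ _ _ _ hsub hz hzero⟩
    rw [card_sdiff_of_subset hsub, hcard, hc, hs, mul_assoc, mul_comm p a]
    omega

theorem auxL_all (n : ℕ) (hn : 0 < n) : auxL n := by
  induction n using Nat.strong_induction_on with
  | _ n ih =>
    by_cases h1 : n = 1
    · rw [h1]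
      exact auxL_one
    · obtain ⟨p, hp, a, rfl⟩ := Nat.exists_prime_and_dvd h1
      have ha : 0 < a := Nat.pos_of_mul_pos_left hn
      have := hp.two_le
      rw [mul_comm]
      exact auxL_step p a hp ha (ih a (by nlinarith) ha)

theorem aux_main (n ℓ : ℕ) (hn : 0 < n)
    (hℓ : IsLeast {m : ℕ | 4 ≤ m ∧ ¬ m ∣ n} ℓ) {ι : Type} [DecidableEq ι]
    (s : Finset ι) (x y : ι → ℤ) (hs : 4 * n - ℓ + 1 ≤ #s) (hz : auxZ n x y s) :
    ∃ T ⊆ s, #T = n ∧ auxZ n x y T := by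
  by_cases h4 : 4 * n - 3 ≤ #s
  · exact auxK_all n hn ι s x y h4
  obtain ⟨k, hk⟩ : ∃ k, #s + k = 4 * n := ⟨4 * n - #s, by omega⟩
  have hkn : k ∣ n := by
    by_contra hd
    have := hℓ.2 (show k ∈ {m : ℕ | 4 ≤ m ∧ ¬ m ∣ n} from ⟨by omega, hd⟩)
    omega
  obtain ⟨b, rfl⟩ := hkn
  have hb : 0 < b := Nat.pos_of_mul_pos_left hn
  have e : (4 * b - 4) * k + 3 * k + k = 4 * (k * b) := by
    obtain ⟨c, rfl⟩ : ∃ c, b = c + 1 := ⟨b - 1, by omega⟩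
    rw [show 4 * (c + 1) - 4 = 4 * c by omega]
    ring
  obtain ⟨B, hB⟩ := aux_extra k (4 * b - 4) (by omega) (auxL_all k (by omega)) s x y (by omega)
    (auxZ_of_dvd ⟨b, rfl⟩ hz)
  exact aux_combine k b _ (auxK_all b hb) s x y B hB (by omega)

theorem square_upper_cor (n ℓ : ℕ) (hn : 0 < n)
    (hℓ : IsLeast {m : ℕ | 4 ≤ m ∧ ¬ m ∣ n} ℓ)
    (J : Multiset (ZMod n × ZMod n)) (hJ : 4 * n - ℓ + 1 ≤ Multiset.card J)
    (hsum : J.sum = 0) :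
    ∃ S ≤ J, Multiset.card S = n ∧ S.sum = 0 := by
  have : NeZero n := ⟨by omega⟩
  induction J using Quotient.inductionOn with
  | h l =>
    have hmap : (univ : Finset (Fin l.length)).val.map l.get = (l : Multiset (ZMod n × ZMod n)) := by
      rw [Fin.univ_val_map, List.ofFn_get]
    have hval : ∀ T : Finset (Fin l.length), (T.val.map l.get).sum = 0 ↔
        auxZ n (fun i => ((l.get i).1.val : ℤ)) (fun i => ((l.get i).2.val : ℤ)) T := by
      intro T
      rw [auxZ_iff]
      change ∑ i ∈ T, l.get i = 0 ↔ _
      simp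
    obtain ⟨T, _, hTc, hz⟩ := aux_main n ℓ hn hℓ (univ : Finset (Fin l.length))
      (fun i => ((l.get i).1.val : ℤ)) (fun i => ((l.get i).2.val : ℤ))
      (by simpa using hJ) (by rw [← hval, hmap]; exact hsum)
    refine ⟨T.val.map l.get, ?_, by simpa using hTc, (hval T).2 hz⟩
    change _ ≤ (l : Multiset (ZMod n × ZMod n))
    rw [← hmap]
    exact Multiset.map_le_map (Finset.val_le_iff.2 (subset_univ T))
end

section
/- The modified Erdős–Ginzburg–Ziv constant s'_n((ℤ/nℤ)²) equals 4n - ℓ + 1, where ℓ is the smallest integer with ℓ ≥ 4 and ℓ ∤ n. -/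
namespace MEGZ
open Finset

lemma alt_sum {R ι κ : Type*} [CommRing R] [DecidableEq ι] [DecidableEq κ] (w : κ → ι → R)
    (T : Finset κ) : ∀ (J : Finset ι) (c : κ → R), T.card < J.card →
    ∑ S ∈ J.powerset, (-1 : R) ^ S.card * ∏ j ∈ T, (c j + ∑ i ∈ S, w j i) = 0 := by
  induction T using Finset.induction_on with
  | empty =>
    intro J c h
    have hJ : J.Nonempty := Finset.card_pos.1 (by simpa using h)
    simp only [Finset.prod_empty, mul_one]
    have := Finset.sum_powerset_neg_one_pow_card_of_nonempty hJ
    have h2 := congrArg (Int.cast : ℤ → R) this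
    push_cast at h2
    exact h2
  | insert a T ha ih =>
    intro J c h
    rw [Finset.card_insert_of_notMem ha] at h
    have key : ∀ S ∈ J.powerset,
        (-1 : R) ^ S.card * ∏ j ∈ insert a T, (c j + ∑ i ∈ S, w j i) =
        c a * ((-1 : R) ^ S.card * ∏ j ∈ T, (c j + ∑ i ∈ S, w j i)) +
        ∑ i ∈ J, w a i * (if i ∈ S then (-1 : R) ^ S.card * ∏ j ∈ T, (c j + ∑ i ∈ S, w j i) else 0) := by
      intro S hS
      rw [Finset.prod_insert ha]
      have : ∑ i ∈ S, w a i = ∑ i ∈ J, if i ∈ S then w a i else 0 := by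
        rw [← Finset.sum_filter]
        congr 1
        ext i
        simp only [Finset.mem_filter]
        exact ⟨fun hi => ⟨Finset.mem_powerset.1 hS hi, hi⟩, fun hi => hi.2⟩
      have h3 : ∑ i ∈ J, w a i * (if i ∈ S then (-1 : R) ^ S.card * ∏ j ∈ T, (c j + ∑ i ∈ S, w j i) else 0)
          = (∑ i ∈ S, w a i) * ((-1 : R) ^ S.card * ∏ j ∈ T, (c j + ∑ i ∈ S, w j i)) := by
        rw [this, Finset.sum_mul]
        refine Finset.sum_congr rfl fun i _ => ?_
        split_ifs <;> simp
      rw [h3]; ring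
    rw [Finset.sum_congr rfl key, Finset.sum_add_distrib, ← Finset.mul_sum, ih J c (by omega),
      mul_zero, zero_add, Finset.sum_comm]
    refine Finset.sum_eq_zero fun i hi => ?_
    rw [← Finset.mul_sum]
    have hz : ∑ S ∈ J.powerset, (if i ∈ S then (-1 : R) ^ S.card * ∏ j ∈ T, (c j + ∑ i ∈ S, w j i) else 0) = 0 := by
      conv_lhs => rw [← Finset.insert_erase hi]
      rw [Finset.sum_powerset_insert (Finset.notMem_erase i J)]
      have h1 : ∑ S ∈ (J.erase i).powerset, (if i ∈ S then (-1 : R) ^ S.card * ∏ j ∈ T, (c j + ∑ i ∈ S, w j i) else 0) = 0 := by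
        refine Finset.sum_eq_zero fun S hS => ?_
        rw [if_neg]
        intro h; exact Finset.notMem_erase i J (Finset.mem_powerset.1 hS h)
      have h2 := ih (J.erase i) (fun j => c j + w j i) (by rw [Finset.card_erase_of_mem hi]; omega)
      rw [h1, zero_add, ← neg_eq_zero, ← h2, ← Finset.sum_neg_distrib]
      refine Finset.sum_congr rfl fun S hS => ?_
      have hiS : i ∉ S := fun h => Finset.notMem_erase i J (Finset.mem_powerset.1 hS h)
      rw [if_pos (Finset.mem_insert_self i S), Finset.card_insert_of_notMem hiS, pow_succ]
      simp only [Finset.sum_insert hiS, add_assoc]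
      ring
    rw [hz, mul_zero]

section prime
variable {p : ℕ} [hp : Fact p.Prime] {ι : Type*} [DecidableEq ι]

/-- number of zero-sum subsets of size `k`, mod `p` -/
def N (f : ι → ZMod p × ZMod p) (k : ℕ) (J : Finset ι) : ZMod p :=
  ∑ S ∈ J.powersetCard k, if ∑ i ∈ S, f i = 0 then 1 else 0

lemma prod_ind (a : ZMod p) : ∃ K : ZMod p, K ≠ 0 ∧ ∀ x,
    ∏ c ∈ univ.erase a, (x - c) = if x = a then K else 0 := by
  refine ⟨∏ c ∈ univ.erase a, (a - c), ?_, fun x => ?_⟩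
  · rw [Finset.prod_ne_zero_iff]
    intro c hc h
    exact (Finset.mem_erase.1 hc).1 (sub_eq_zero.1 h).symm
  · split_ifs with h
    · rw [h]
    · exact Finset.prod_eq_zero (i := x) (by simp [h]) (by simp)

lemma core (f : ι → ZMod p × ZMod p) (C : Finset (ZMod p)) (J : Finset ι)
    (h : C.card + 2 * (p - 1) < J.card) :
    ∑ k ∈ range (J.card + 1), (-1) ^ k * (∏ c ∈ C, ((k : ZMod p) - c)) * N f k J = 0 := by
  have hc : (univ.erase (0 : ZMod p)).card = p - 1 := by
    rw [Finset.card_erase_of_mem (mem_univ _), Finset.card_univ, ZMod.card]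
  have h0 := alt_sum (R := ZMod p) (ι := ι) (κ := ZMod p ⊕ (ZMod p ⊕ ZMod p))
    (fun j i => Sum.elim (fun _ => 1) (Sum.elim (fun _ => (f i).1) (fun _ => (f i).2)) j)
    (C.disjSum ((univ.erase 0).disjSum (univ.erase 0))) J
    (fun j => - Sum.elim id (Sum.elim id id) j)
    (by rw [Finset.card_disjSum, Finset.card_disjSum, hc]; omega)
  simp only [Finset.prod_disjSum, Sum.elim_inl, Sum.elim_inr, id, neg_add_eq_sub] at h0
  obtain ⟨K, hK0, hK⟩ := prod_ind (p := p) 0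
  simp only [hK] at h0
  have h1 : ∀ S ∈ J.powerset, (-1 : ZMod p) ^ S.card * ((∏ x ∈ C, (∑ i ∈ S, 1 - x)) *
      ((if ∑ i ∈ S, (f i).1 = 0 then K else 0) * (if ∑ i ∈ S, (f i).2 = 0 then K else 0))) =
      K ^ 2 * ((-1) ^ S.card * (∏ c ∈ C, ((S.card : ZMod p) - c)) * if ∑ i ∈ S, f i = 0 then 1 else 0) := by
    intro S _
    have : (∑ i ∈ S, f i = 0) ↔ (∑ i ∈ S, (f i).1 = 0 ∧ ∑ i ∈ S, (f i).2 = 0) := by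
      rw [Prod.ext_iff, Prod.fst_sum, Prod.snd_sum]; rfl
    simp only [this, Finset.sum_const, nsmul_eq_mul, mul_one]
    by_cases a1 : ∑ i ∈ S, (f i).1 = 0 <;> by_cases a2 : ∑ i ∈ S, (f i).2 = 0 <;> simp [a1, a2]
    ring
  rw [Finset.sum_congr rfl h1, ← Finset.mul_sum] at h0
  have h2 := (mul_eq_zero.1 h0).resolve_left (pow_ne_zero 2 hK0)
  rw [Finset.sum_powerset] at h2
  rw [← h2]
  refine Finset.sum_congr rfl fun k _ => ?_
  rw [N, Finset.mul_sum]
  refine Finset.sum_congr rfl fun S hS => ?_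
  rw [(Finset.mem_powersetCard.1 hS).2]

lemma core1 (f : ι → ZMod p × ZMod p) (a : ZMod p) (J : Finset ι) (h : 3 * p - 2 ≤ J.card) :
    ∑ k ∈ range (J.card + 1), (if (k : ZMod p) = a then (-1) ^ k * N f k J else 0) = 0 := by
  have hp2 := hp.out.two_le
  have := core f (univ.erase a) J
    (by rw [Finset.card_erase_of_mem (mem_univ _), Finset.card_univ, ZMod.card]; omega)
  obtain ⟨K, hK0, hK⟩ := prod_ind a
  simp only [hK] at this
  refine (mul_eq_zero.1 (Eq.trans ?_ this)).resolve_left hK0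
  rw [Finset.mul_sum]
  refine Finset.sum_congr rfl fun k _ => ?_
  split_ifs
  · ring
  · simp

lemma core2 (hodd : p ≠ 2) (f : ι → ZMod p × ZMod p) (J : Finset ι) (h : 3 * p - 3 ≤ J.card) :
    ∑ k ∈ range (J.card + 1), ((if (k : ZMod p) = 0 then (-1) ^ k * N f k J else 0)
      - (if (k : ZMod p) = -1 then (-1) ^ k * N f k J else 0)) = 0 := by
  have hp2 := hp.out.two_le
  have hmem : (-1 : ZMod p) ∈ univ.erase (0 : ZMod p) := by simp
  have hcard : ((univ.erase (0 : ZMod p)).erase (-1)).card = p - 2 := by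
    rw [Finset.card_erase_of_mem hmem,
      Finset.card_erase_of_mem (mem_univ _), Finset.card_univ, ZMod.card]; omega
  have := core f ((univ.erase 0).erase (-1)) J
    (by rw [hcard]; have := hp.out.two_le; omega)
  set C := (univ.erase (0 : ZMod p)).erase (-1) with hC
  have hpodd : Odd p := hp.out.odd_of_ne_two hodd
  set A := ∏ c ∈ C, ((0 : ZMod p) - c) with hA
  have hA0 : A ≠ 0 := by
    rw [hA, Finset.prod_ne_zero_iff]
    intro c hc
    have : c ≠ 0 := by
      rw [hC] at hc; simp at hc; tauto
    simpa using this
  have hB : ∏ c ∈ C, ((-1 : ZMod p) - c) = -A := by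
    have e1 : ∏ c ∈ C, ((-1 : ZMod p) - c) = ∏ c ∈ C, c := by
      refine Finset.prod_bij' (fun c _ => -1 - c) (fun c _ => -1 - c) ?_ ?_ ?_ ?_ ?_
      · intro c hc; rw [hC] at hc ⊢; simp only [mem_erase, mem_univ, and_true] at hc ⊢
        refine ⟨fun h => hc.2 ?_, fun h => hc.1 ?_⟩ <;> linear_combination -h
      · intro c hc; rw [hC] at hc ⊢; simp only [mem_erase, mem_univ, and_true] at hc ⊢
        refine ⟨fun h => hc.2 ?_, fun h => hc.1 ?_⟩ <;> linear_combination -h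
      · intros; ring
      · intros; ring
      · intros; ring
    have e2 : A = - ∏ c ∈ C, c := by
      rw [hA]
      have e3 : ∀ c ∈ C, (0 : ZMod p) - c = (-1) * c := fun c _ => by ring
      rw [Finset.prod_congr rfl e3, Finset.prod_mul_distrib, Finset.prod_const, hcard]
      have : Odd (p - 2) := by
        obtain ⟨t, ht⟩ := hpodd
        have : 3 ≤ p := by omega
        exact ⟨t - 1, by omega⟩
      rw [this.neg_one_pow]; ring
    rw [e1, e2]; ring
  have hv : ∀ x : ZMod p, ∏ c ∈ C, (x - c) = A * ((if x = 0 then 1 else 0) - if x = -1 then 1 else 0) := by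
    intro x
    by_cases h0 : x = 0
    · subst h0; rw [← hA]; simp
    · by_cases h1 : x = -1
      · subst h1; rw [hB]; simp
      · rw [Finset.prod_eq_zero (i := x)]
        · simp [h0, h1]
        · simp [hC, h0, h1]
        · simp
  simp only [hv] at this
  refine (mul_eq_zero.1 (Eq.trans ?_ this)).resolve_left hA0
  rw [Finset.mul_sum]
  refine Finset.sum_congr rfl fun k _ => ?_
  split_ifs <;> ring

lemma N_zero (f : ι → ZMod p × ZMod p) (J : Finset ι) : N f 0 J = 1 := by
  rw [N, Finset.powersetCard_zero, Finset.sum_singleton]; simp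

lemma N_big (f : ι → ZMod p × ZMod p) (J : Finset ι) (k : ℕ) (h : J.card < k) : N f k J = 0 := by
  rw [N, Finset.powersetCard_eq_empty.2 h]; simp

lemma castz (k : ℕ) : ((k : ZMod p) = 0) ↔ p ∣ k := ZMod.natCast_eq_zero_iff k p
lemma castm (k : ℕ) : ((k : ZMod p) = -1) ↔ p ∣ k + 1 := by
  rw [← ZMod.natCast_eq_zero_iff, eq_neg_iff_add_eq_zero]; push_cast; rfl

lemma sum0 (J : ℕ) (h : J < 4 * p) (g : ℕ → ZMod p) (hg : ∀ k, J < k → g k = 0) :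
    ∑ k ∈ range (J + 1), (if (k : ZMod p) = 0 then g k else 0) = g 0 + g p + g (2 * p) + g (3 * p) := by
  have hp2 := hp.out.two_le
  have e : ∑ k ∈ range (J + 1), (if (k : ZMod p) = 0 then g k else 0)
      = ∑ k ∈ range (4 * p), (if (k : ZMod p) = 0 then g k else 0) := by
    refine Finset.sum_subset (fun x hx => by simp at hx ⊢; omega) fun k _ hk => ?_
    rw [hg k (by simp at hk; omega)]; simp
  rw [e, ← Finset.sum_filter]
  have : (range (4 * p)).filter (fun k : ℕ => (k : ZMod p) = 0) = {0, p, 2 * p, 3 * p} := by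
    ext k
    simp only [mem_filter, mem_range, castz, mem_insert, mem_singleton]
    constructor
    · rintro ⟨h1, c, rfl⟩
      have : c < 4 := by by_contra hc; push Not at hc; nlinarith
      interval_cases c <;> simp [mul_comm]
    · rintro (rfl | rfl | rfl | rfl) <;> simp <;> omega
  rw [this, Finset.sum_insert, Finset.sum_insert, Finset.sum_insert, Finset.sum_singleton]
  · ring
  all_goals simp; try omega

lemma summ (J : ℕ) (h : J < 4 * p - 1) (g : ℕ → ZMod p) (hg : ∀ k, J < k → g k = 0) :
    ∑ k ∈ range (J + 1), (if (k : ZMod p) = -1 then g k else 0)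
      = g (p - 1) + g (2 * p - 1) + g (3 * p - 1) := by
  have hp2 := hp.out.two_le
  have e : ∑ k ∈ range (J + 1), (if (k : ZMod p) = -1 then g k else 0)
      = ∑ k ∈ range (4 * p - 1), (if (k : ZMod p) = -1 then g k else 0) := by
    refine Finset.sum_subset (fun x hx => by simp at hx ⊢; omega) fun k _ hk => ?_
    rw [hg k (by simp at hk; omega)]; simp
  rw [e, ← Finset.sum_filter]
  have : (range (4 * p - 1)).filter (fun k : ℕ => (k : ZMod p) = -1) = {p - 1, 2 * p - 1, 3 * p - 1} := by
    ext k
    simp only [mem_filter, mem_range, castm, mem_insert, mem_singleton]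
    constructor
    · rintro ⟨h1, c, hc⟩
      have : c < 4 := by by_contra hc; push Not at hc; nlinarith [Nat.sub_add_cancel (show 1 ≤ 4 * p by omega)]
      interval_cases c <;> omega
    · rintro (rfl | rfl | rfl)
      · exact ⟨by omega, 1, by omega⟩
      · exact ⟨by omega, 2, by omega⟩
      · exact ⟨by omega, 3, by omega⟩
  rw [this, Finset.sum_insert, Finset.sum_insert, Finset.sum_singleton]
  · ring
  all_goals simp; try omega

end prime
end MEGZ

namespace MEGZ
open Finset

section prime
variable {p : ℕ} [hp : Fact p.Prime] {ι : Type*} [DecidableEq ι]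

lemma two_self : ∀ v : ZMod 2 × ZMod 2, v + v = 0 := by decide

lemma negp : (-1 : ZMod p) ^ p = -1 := ZMod.pow_card _

lemma L2 (f : ι → ZMod p × ZMod p) (J : Finset ι) (h : 3 * p - 2 ≤ J.card) (h' : J.card < 4 * p) :
    1 - N f p J + N f (2 * p) J - N f (3 * p) J = 0 := by
  have := core1 f 0 J h
  rw [sum0 J.card h' (fun k => (-1) ^ k * N f k J) (fun k hk => by simp [N_big f J k hk])] at this
  rw [← this]
  simp only [mul_comm _ p, pow_mul, negp, N_zero]
  ring

lemma pow_pred : (-1 : ZMod p) ^ (p - 1) = 1 := ZMod.pow_card_sub_one_eq_one (by simp)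
lemma pow_2pred : (-1 : ZMod p) ^ (2 * p - 1) = -1 := by
  have h := hp.out.two_le
  rw [show 2 * p - 1 = (p - 1) + p by omega, pow_add, pow_pred, negp]; ring
lemma pow_3pred : (-1 : ZMod p) ^ (3 * p - 1) = 1 := by
  have h := hp.out.two_le
  rw [show 3 * p - 1 = (p - 1) + p + p by omega, pow_add, pow_add, pow_pred, negp]; ring

lemma L3 (f : ι → ZMod p × ZMod p) (J : Finset ι) (h : 3 * p - 2 ≤ J.card) (h' : J.card < 4 * p - 1) :
    N f (p - 1) J - N f (2 * p - 1) J + N f (3 * p - 1) J = 0 := by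
  have := core1 f (-1) J h
  rw [summ J.card h' (fun k => (-1) ^ k * N f k J) (fun k hk => by simp [N_big f J k hk])] at this
  rw [← this]
  simp only [pow_pred, pow_2pred, pow_3pred]
  ring

lemma L1 (hodd : p ≠ 2) (f : ι → ZMod p × ZMod p) (J : Finset ι) (h : J.card = 3 * p - 3) :
    1 - N f p J + N f (2 * p) J - N f (p - 1) J + N f (2 * p - 1) J = 0 := by
  have hp2 := hp.out.two_le
  have := core2 hodd f J h.ge
  rw [Finset.sum_sub_distrib, 
    sum0 J.card (by omega) (fun k => (-1) ^ k * N f k J) (fun k hk => by simp [N_big f J k hk]),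
    summ J.card (by omega) (fun k => (-1) ^ k * N f k J) (fun k hk => by simp [N_big f J k hk])] at this
  simp only [pow_pred, pow_2pred, pow_3pred] at this
  rw [N_big f J (3 * p - 1) (by omega), N_big f J (3 * p) (by omega)] at this
  rw [← this]
  simp only [mul_comm _ p, pow_mul, negp, N_zero]
  ring

lemma N_pos (f : ι → ZMod p × ZMod p) (J : Finset ι) (k : ℕ) (h : N f k J ≠ 0) :
    ∃ S ⊆ J, S.card = k ∧ ∑ i ∈ S, f i = 0 := by
  obtain ⟨S, hS, h2⟩ := Finset.exists_ne_zero_of_sum_ne_zero h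
  rw [Finset.mem_powersetCard] at hS
  exact ⟨S, hS.1, hS.2, by by_contra h3; simp [h3] at h2⟩

lemma N_none (f : ι → ZMod p × ZMod p) (J : Finset ι) (k : ℕ)
    (h : ∀ S ⊆ J, S.card = k → ∑ i ∈ S, f i ≠ 0) : N f k J = 0 := by
  by_contra h0
  obtain ⟨S, h1, h2, h3⟩ := N_pos f J k h0
  exact h S h1 h2 h3

/-- Davenport-type statement -/
lemma dav (f : ι → ZMod p × ZMod p) (J : Finset ι) (h : 3 * p - 2 ≤ J.card) :
    ∃ S ⊆ J, (S.card = p ∨ S.card = 2 * p) ∧ ∑ i ∈ S, f i = 0 := by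
  have hp2 := hp.out.two_le
  obtain ⟨J', hJ', hc⟩ := Finset.exists_subset_card_eq h
  have := L2 f J' hc.ge (by omega)
  rw [N_big f J' (3 * p) (by omega)] at this
  by_cases h1 : N f p J' = 0
  · have h2 : N f (2 * p) J' ≠ 0 := by
      intro h2
      rw [h1, h2] at this
      simp at this
    obtain ⟨S, hS, a, b⟩ := N_pos f J' _ h2
    exact ⟨S, hS.trans hJ', Or.inr a, b⟩
  · obtain ⟨S, hS, a, b⟩ := N_pos f J' _ h1
    exact ⟨S, hS.trans hJ', Or.inl a, b⟩

lemma dav3 (f : ι → ZMod p × ZMod p) (J : Finset ι) (h : J.card = 3 * p) (hs : ∑ i ∈ J, f i = 0) :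
    ∃ S ⊆ J, S.card = p ∧ ∑ i ∈ S, f i = 0 := by
  obtain ⟨S, hS, a | a, b⟩ := dav f J (by omega)
  · exact ⟨S, hS, a, b⟩
  · refine ⟨J \ S, Finset.sdiff_subset, ?_, ?_⟩
    · rw [Finset.card_sdiff_of_subset hS]; omega
    · have := Finset.sum_sdiff (f := f) hS
      rw [b, hs, add_zero] at this
      exact this

lemma dcount (f : ι → ZMod p × ZMod p) (J : Finset ι) (k q : ℕ) :
    ∑ C ∈ J.powersetCard q, N f k (J \ C) = ((J.card - k).choose q : ZMod p) * N f k J := by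
  unfold N
  rw [Finset.mul_sum]
  rw [Finset.sum_comm' (t' := J.powersetCard k) (s' := fun S => (J \ S).powersetCard q)]
  · refine Finset.sum_congr rfl fun S hS => ?_
    rw [Finset.mem_powersetCard] at hS
    rw [Finset.sum_const, Finset.card_powersetCard, Finset.card_sdiff_of_subset hS.1, hS.2, nsmul_eq_mul]
  · intro C S
    simp only [Finset.mem_powersetCard, Finset.subset_sdiff]
    constructor
    · rintro ⟨⟨a, b⟩, ⟨c, d⟩, e⟩
      exact ⟨⟨⟨a, d.symm⟩, b⟩, c, e⟩
    · rintro ⟨⟨⟨a, d⟩, b⟩, c, e⟩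
      exact ⟨⟨a, b⟩, ⟨c, d.symm⟩, e⟩

lemma choose_p (m r : ℕ) (hr : r < p) : (((m * p + r).choose p : ℕ) : ZMod p) = m := by
  have h := Choose.choose_modEq_choose_mod_mul_choose_div_nat (n := m * p + r) (k := p) (p := p)
  have hp0 := hp.out.pos
  have e1 : (m * p + r) / p = m := by
    rw [mul_comm, Nat.mul_add_div hp0, Nat.div_eq_of_lt hr]; simp
  rw [Nat.mod_self, Nat.choose_zero_right, Nat.div_self hp0, e1, Nat.choose_one_right, one_mul] at h
  exact (ZMod.natCast_eq_natCast_iff _ _ _).2 h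

lemma L4 (hodd : p ≠ 2) (f : ι → ZMod p × ZMod p) (J : Finset ι) (h : J.card = 4 * p - 3) :
    3 - 2 * N f p J + N f (2 * p) J - 2 * N f (p - 1) J + N f (2 * p - 1) J = 0 := by
  have hp2 := hp.out.two_le
  have hp3 : 3 ≤ p := by omega
  have key : ∑ C ∈ J.powersetCard p, (N f 0 (J \ C) - N f p (J \ C) + N f (2 * p) (J \ C)
      - N f (p - 1) (J \ C) + N f (2 * p - 1) (J \ C)) = 0 := by
    refine Finset.sum_eq_zero fun C hC => ?_
    rw [Finset.mem_powersetCard] at hC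
    rw [N_zero]
    exact L1 hodd f _ (by rw [Finset.card_sdiff_of_subset hC.1]; omega)
  simp only [Finset.sum_add_distrib, Finset.sum_sub_distrib, dcount, h] at key
  rw [show 4 * p - 3 - 0 = 3 * p + (p - 3) by omega, show 4 * p - 3 - p = 2 * p + (p - 3) by omega,
    show 4 * p - 3 - 2 * p = 1 * p + (p - 3) by omega,
    show 4 * p - 3 - (p - 1) = 2 * p + (p - 2) by omega,
    show 4 * p - 3 - (2 * p - 1) = 1 * p + (p - 2) by omega,
    choose_p _ _ (by omega), choose_p _ _ (by omega), choose_p _ _ (by omega),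
    choose_p _ _ (by omega), choose_p _ _ (by omega), N_zero] at key
  push_cast at key
  linear_combination key

lemma L5 (f : ι → ZMod p × ZMod p) (J : Finset ι) (h : J.card = 4 * p - 3)
    (hno : ∀ S ⊆ J, S.card = p → ∑ i ∈ S, f i ≠ 0) :
    N f (p - 1) J = N f (3 * p - 1) J := by
  have hp2 := hp.out.two_le
  have hsub : ∀ D ⊆ J, 3 * p - 2 ≤ D.card → D.card < 3 * p → N f (2 * p) D = -1 := by
    intro D hD h1 h2
    have := L2 f D h1 (by omega)
    rw [N_big f D (3 * p) h2, N_none f D p (fun S hS => hno S (hS.trans hD))] at this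
    linear_combination this
  have e1 : ∑ A ∈ J.powersetCard (p - 1), (if ∑ i ∈ A, f i = 0 then N f (2 * p) (J \ A) else 0)
      = - N f (p - 1) J := by
    rw [N, ← Finset.sum_neg_distrib]
    refine Finset.sum_congr rfl fun A hA => ?_
    rw [Finset.mem_powersetCard] at hA
    split_ifs
    · exact hsub _ Finset.sdiff_subset (by rw [Finset.card_sdiff_of_subset hA.1]; omega)
        (by rw [Finset.card_sdiff_of_subset hA.1]; omega)
    · simp
  have e2 : ∑ D ∈ J.powersetCard (3 * p - 1), (if ∑ i ∈ D, f i = 0 then N f (2 * p) D else 0)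
      = - N f (3 * p - 1) J := by
    rw [N, ← Finset.sum_neg_distrib]
    refine Finset.sum_congr rfl fun A hA => ?_
    rw [Finset.mem_powersetCard] at hA
    split_ifs
    · exact hsub _ hA.1 (by omega) (by omega)
    · simp
  have e3 : ∑ A ∈ J.powersetCard (p - 1), (if ∑ i ∈ A, f i = 0 then N f (2 * p) (J \ A) else 0)
      = ∑ D ∈ J.powersetCard (3 * p - 1), (if ∑ i ∈ D, f i = 0 then N f (2 * p) D else 0) := by
    have t1 : ∀ A ∈ J.powersetCard (p - 1), (if ∑ i ∈ A, f i = 0 then N f (2 * p) (J \ A) else 0)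
      = ∑ C ∈ (J \ A).powersetCard (2 * p),
        (if ∑ i ∈ A, f i = 0 ∧ ∑ i ∈ C, f i = 0 then (1 : ZMod p) else 0) := by
      intro A _
      split_ifs with h
      · simp [N, h]
      · simp [h]
    have t2 : ∀ D ∈ J.powersetCard (3 * p - 1), (if ∑ i ∈ D, f i = 0 then N f (2 * p) D else 0)
      = ∑ C ∈ D.powersetCard (2 * p),
        (if ∑ i ∈ D, f i = 0 ∧ ∑ i ∈ C, f i = 0 then (1 : ZMod p) else 0) := by
      intro A _
      split_ifs with h
      · simp [N, h]
      · simp [h]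
    rw [Finset.sum_congr rfl t1, Finset.sum_congr rfl t2, Finset.sum_sigma', Finset.sum_sigma']
    refine Finset.sum_bij' (fun x _ => ⟨x.1 ∪ x.2, x.2⟩) (fun x _ => ⟨x.1 \ x.2, x.2⟩) ?_ ?_ ?_ ?_ ?_
    · rintro ⟨A, C⟩ hx
      simp only [Finset.mem_sigma, Finset.mem_powersetCard, Finset.subset_sdiff] at hx ⊢
      obtain ⟨⟨a, b⟩, ⟨c, d⟩, e⟩ := hx
      refine ⟨⟨Finset.union_subset a c, ?_⟩, Finset.subset_union_right, e⟩
      rw [Finset.card_union_of_disjoint d.symm]; omega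
    · rintro ⟨D, C⟩ hx
      simp only [Finset.mem_sigma, Finset.mem_powersetCard, Finset.subset_sdiff] at hx ⊢
      obtain ⟨⟨a, b⟩, c, d⟩ := hx
      refine ⟨⟨Finset.sdiff_subset.trans a, ?_⟩, ⟨c.trans a, Finset.disjoint_sdiff⟩, d⟩
      rw [Finset.card_sdiff_of_subset c]; omega
    · rintro ⟨A, C⟩ hx
      simp only [Finset.mem_sigma, Finset.mem_powersetCard, Finset.subset_sdiff] at hx ⊢
      obtain ⟨⟨a, b⟩, ⟨c, d⟩, e⟩ := hx
      rw [Finset.union_sdiff_cancel_right d.symm]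
    · rintro ⟨D, C⟩ hx
      simp only [Finset.mem_sigma, Finset.mem_powersetCard, Finset.subset_sdiff] at hx ⊢
      obtain ⟨⟨a, b⟩, c, d⟩ := hx
      rw [Finset.sdiff_union_of_subset c]
    · rintro ⟨A, C⟩ hx
      simp only [Finset.mem_sigma, Finset.mem_powersetCard, Finset.subset_sdiff] at hx ⊢
      obtain ⟨⟨a, b⟩, ⟨c, d⟩, e⟩ := hx
      rw [Finset.sum_union d.symm]
      refine if_congr ?_ rfl rfl
      constructor
      · rintro ⟨u, v⟩; simp [u, v]
      · rintro ⟨u, v⟩; exact ⟨by simpa [v] using u, v⟩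
  rw [e1, e2] at e3
  exact neg_injective e3

lemma kemnitz_prime (f : ι → ZMod p × ZMod p) (J : Finset ι) (h : 4 * p - 3 ≤ J.card) :
    ∃ S ⊆ J, S.card = p ∧ ∑ i ∈ S, f i = 0 := by
  have hp2 := hp.out.two_le
  by_cases hodd : p = 2
  · subst hodd
    obtain ⟨x, hx, y, hy, hxy, he⟩ := Finset.exists_ne_map_eq_of_card_lt_of_maps_to
      (s := J) (t := (univ : Finset (ZMod 2 × ZMod 2))) (f := f)
      (by rw [Finset.card_univ, Fintype.card_prod, ZMod.card]; omega) (fun _ _ => by simp)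
    refine ⟨{x, y}, by intro z hz; simp at hz; rcases hz with rfl | rfl <;> assumption,
      Finset.card_pair hxy, ?_⟩
    rw [Finset.sum_pair hxy, he]
    exact two_self _
  · by_contra hcon
    obtain ⟨J', hJ', hc⟩ := Finset.exists_subset_card_eq h
    have hno : ∀ S ⊆ J', S.card = p → ∑ i ∈ S, f i ≠ 0 := fun S hS h1 h2 =>
      hcon ⟨S, hS.trans hJ', h1, h2⟩
    have n1 : N f p J' = 0 := N_none f J' p hno
    have n3 : N f (3 * p) J' = 0 := by
      refine N_none f J' _ fun D hD h1 h2 => ?_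
      obtain ⟨S, hS, a, b⟩ := dav3 f D h1 h2
      exact hno S (hS.trans hD) a b
    have a1 := L2 f J' (by omega) (by omega)
    have a2 := L3 f J' (by omega) (by omega)
    have a3 := L4 hodd f J' hc
    have a4 := L5 f J' hc hno
    rw [n1, n3] at a1
    rw [n1] at a3
    have : (2 : ZMod p) = 0 := by linear_combination a3 - a1 + a2 + a4
    have h2 : ((2 : ℕ) : ZMod p) = 0 := by exact_mod_cast this
    rw [ZMod.natCast_eq_zero_iff] at h2
    exact hodd ((Nat.prime_dvd_prime_iff_eq hp.out Nat.prime_two).1 h2)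

end prime
end MEGZ

namespace MEGZ

lemma le_map_exists {α β : Type*} (w : α → β) (S : Multiset β) (B : Multiset α)
    (h : S ≤ B.map w) : ∃ B' ≤ B, B'.map w = S := by
  induction S using Quotient.inductionOn with
  | h s =>
  induction B using Quotient.inductionOn with
  | h b =>
    rw [Multiset.quot_mk_to_coe, Multiset.quot_mk_to_coe, Multiset.map_coe, Multiset.coe_le] at h
    obtain ⟨l, h1, h2⟩ := h
    obtain ⟨l', h3, rfl⟩ := List.sublist_map_iff.1 h2
    refine ⟨l', ?_, ?_⟩
    · rw [Multiset.quot_mk_to_coe, Multiset.coe_le]; exact h3.subperm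
    · rw [Multiset.quot_mk_to_coe, Multiset.map_coe]; exact Multiset.coe_eq_coe.2 h1

/-- The sum of `S` is divisible by `n`. -/
def Dv (n : ℕ) (S : Multiset (ℤ × ℤ)) : Prop := ∃ w : ℤ × ℤ, S.sum = n • w

def PP (n : ℕ) : Prop := ∀ J : Multiset (ℤ × ℤ), 4 * n - 3 ≤ J.card →
  ∃ S ≤ J, S.card = n ∧ Dv n S

def QQ (n : ℕ) : Prop := ∀ J : Multiset (ℤ × ℤ), J.card = 3 * n → Dv n J →
  ∃ S ≤ J, S.card = n ∧ Dv n S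

lemma Dv_add {n : ℕ} {S T : Multiset (ℤ × ℤ)} (h1 : Dv n S) (h2 : Dv n T) : Dv n (S + T) := by
  obtain ⟨a, ha⟩ := h1
  obtain ⟨b, hb⟩ := h2
  exact ⟨a + b, by rw [Multiset.sum_add, ha, hb, smul_add]⟩

lemma Dv_sub {n : ℕ} {S T : Multiset (ℤ × ℤ)} (h : S ≤ T) (h1 : Dv n S) (h2 : Dv n T) :
    Dv n (T - S) := by
  obtain ⟨a, ha⟩ := h1
  obtain ⟨b, hb⟩ := h2
  refine ⟨b - a, ?_⟩
  have : (T - S).sum + S.sum = T.sum := by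
    rw [← Multiset.sum_add, tsub_add_cancel_of_le h]
  rw [smul_sub, ← ha, ← hb, ← this, add_sub_cancel_right]

/-- reduction to `ZMod n` -/
def red (n : ℕ) : ℤ × ℤ →+ ZMod n × ZMod n :=
  (Int.castAddHom (ZMod n)).prodMap (Int.castAddHom (ZMod n))

lemma Dv_iff (n : ℕ) (S : Multiset (ℤ × ℤ)) : Dv n S ↔ (S.map (red n)).sum = 0 := by
  rw [← map_multiset_sum]
  simp only [Dv, red, AddMonoidHom.prodMap, AddMonoidHom.prod_apply, AddMonoidHom.comp_apply,
    AddMonoidHom.coe_fst, AddMonoidHom.coe_snd, Int.coe_castAddHom, Prod.mk_eq_zero,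
    ZMod.intCast_zmod_eq_zero_iff_dvd]
  constructor
  · rintro ⟨w, hw⟩
    rw [hw]
    exact ⟨⟨w.1, by simp⟩, ⟨w.2, by simp⟩⟩
  · rintro ⟨⟨a, ha⟩, ⟨b, hb⟩⟩
    exact ⟨(a, b), by ext <;> simp [ha, hb]⟩

/-- Transfer from indexed families to multisets. -/
lemma transfer {p : ℕ} (J : Multiset (ℤ × ℤ)) (c : ℕ → Prop)
    (H : ∃ S ⊆ (Finset.univ : Finset J.ToType), c S.card ∧ ∑ i ∈ S, red p i.1 = 0) :
    ∃ S ≤ J, c S.card ∧ Dv p S := by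
  obtain ⟨S, hS, h1, h2⟩ := H
  refine ⟨S.val.map (fun i => i.1), ?_, ?_, ?_⟩
  · have := Multiset.map_le_map (f := fun i : J.ToType => i.1) (Finset.val_le_iff.2 hS)
    rwa [Multiset.map_univ_coe] at this
  · simpa using h1
  · rw [Dv_iff, Multiset.map_map]
    exact h2

lemma PP_prime {p : ℕ} (hp : p.Prime) : PP p := by
  intro J hJ
  have : Fact p.Prime := ⟨hp⟩
  classical
  refine transfer J (fun k => k = p) (kemnitz_prime (fun i : J.ToType => red p i.1) _ ?_)
  simpa using hJ

lemma DD_prime {p : ℕ} (hp : p.Prime) (J : Multiset (ℤ × ℤ)) (hJ : 3 * p - 2 ≤ J.card) :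
    ∃ S ≤ J, (S.card = p ∨ S.card = 2 * p) ∧ Dv p S := by
  have : Fact p.Prime := ⟨hp⟩
  classical
  refine transfer J (fun k => k = p ∨ k = 2 * p) (dav (fun i : J.ToType => red p i.1) _ ?_)
  simpa using hJ

lemma PP_one : PP 1 := by
  intro J hJ
  obtain ⟨a, ha⟩ := Multiset.card_pos_iff_exists_mem.1 (show 0 < J.card by omega)
  exact ⟨{a}, Multiset.singleton_le.2 ha, by simp, a, by simp⟩

lemma QQ_one : QQ 1 := fun J hJ _ => PP_one J (by omega)

/-- a family of disjoint blocks -/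
def Blocks (m : ℕ) (J : Multiset (ℤ × ℤ)) (B : Multiset (Multiset (ℤ × ℤ))) : Prop :=
  B.sum ≤ J ∧ ∀ b ∈ B, b.card = m ∧ Dv m b

lemma Blocks.card {m : ℕ} {J : Multiset (ℤ × ℤ)} {B : Multiset (Multiset (ℤ × ℤ))}
    (h : Blocks m J B) : B.sum.card = B.card * m := by
  have := h.2
  clear h
  induction B using Multiset.induction_on with
  | empty => simp
  | cons b B ih =>
    rw [Multiset.sum_cons, Multiset.card_add, ih (fun x hx => this x (Multiset.mem_cons_of_mem hx)),
      (this b (Multiset.mem_cons_self b B)).1, Multiset.card_cons]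
    ring

lemma Blocks.dv {m : ℕ} {J : Multiset (ℤ × ℤ)} {B : Multiset (Multiset (ℤ × ℤ))}
    (h : Blocks m J B) : Dv m B.sum := by
  have := h.2
  clear h
  induction B using Multiset.induction_on with
  | empty => exact ⟨0, by simp⟩
  | cons b B ih =>
    rw [Multiset.sum_cons]
    exact Dv_add (this b (Multiset.mem_cons_self b B)).2
      (ih (fun x hx => this x (Multiset.mem_cons_of_mem hx)))

lemma Blocks.cons {m : ℕ} {J : Multiset (ℤ × ℤ)} {B : Multiset (Multiset (ℤ × ℤ))}
    (h : Blocks m J B) {b : Multiset (ℤ × ℤ)} (hb : b ≤ J - B.sum) (h1 : b.card = m) (h2 : Dv m b) :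
    Blocks m J (b ::ₘ B) := by
  refine ⟨?_, ?_⟩
  · rw [Multiset.sum_cons]
    calc b + B.sum ≤ (J - B.sum) + B.sum := by gcongr
      _ = J := tsub_add_cancel_of_le h.1
  · intro x hx
    rcases Multiset.mem_cons.1 hx with rfl | hx
    · exact ⟨h1, h2⟩
    · exact h.2 x hx

lemma extract {m : ℕ} (hm : PP m) (J : Multiset (ℤ × ℤ)) : ∀ j : ℕ,
    j * m + (4 * m - 3) ≤ J.card + m → ∃ B, Blocks m J B ∧ B.card = j := by
  intro j
  induction j with
  | zero => intro _; exact ⟨0, ⟨by simp, by simp⟩, rfl⟩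
  | succ j ih =>
    intro h
    rw [add_mul, one_mul] at h
    obtain ⟨B, hB, hj⟩ := ih (by omega)
    obtain ⟨b, hb, h1, h2⟩ := hm (J - B.sum) (by
      rw [Multiset.card_sub hB.1, hB.card, hj]; omega)
    exact ⟨b ::ₘ B, hB.cons hb h1 h2, by simp [hj]⟩

/-- choosing sub-blocks -/
lemma lift_blocks {m : ℕ} {J : Multiset (ℤ × ℤ)} {B : Multiset (Multiset (ℤ × ℤ))}
    (h : Blocks m J B) (q : ℕ) (c : ℕ → Prop)
    (H : ∀ K : Multiset (ℤ × ℤ), K.card = B.card → ∃ S ≤ K, c S.card ∧ Dv q S) :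
    ∃ S ≤ J, (∃ t, c t ∧ S.card = t * m) ∧ Dv (m * q) S := by
  classical
  have hch : ∀ b : Multiset (ℤ × ℤ), ∃ w : ℤ × ℤ, b ∈ B → b.sum = m • w := by
    intro b
    by_cases hb : b ∈ B
    · obtain ⟨w, hw⟩ := (h.2 b hb).2
      exact ⟨w, fun _ => hw⟩
    · exact ⟨0, fun h => absurd h hb⟩
  choose w hw using hch
  obtain ⟨S, hS, h1, v, hv⟩ := H (B.map w) (by simp)
  obtain ⟨B', hB', rfl⟩ : ∃ B' ≤ B, B'.map w = S := le_map_exists w S B hS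
  have hle : B'.sum ≤ B.sum := by
    obtain ⟨D, rfl⟩ := Multiset.le_iff_exists_add.1 hB'
    rw [Multiset.sum_add]
    exact Multiset.le_add_right _ _
  have hbl : Blocks m J B' := ⟨hle.trans h.1, fun b hb => h.2 b (Multiset.mem_of_le hB' hb)⟩
  refine ⟨B'.sum, hbl.1, ⟨B'.card, by simpa using h1, hbl.card⟩, v, ?_⟩
  have : ∀ B'' : Multiset (Multiset (ℤ × ℤ)), B'' ≤ B → B''.sum.sum = m • (B''.map w).sum := by
    intro B''
    induction B'' using Multiset.induction_on with
    | empty => intro _; simp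
    | cons b B'' ih =>
      intro hb
      rw [Multiset.sum_cons, Multiset.sum_add, ih ((Multiset.le_cons_self _ _).trans hb),
        hw b (Multiset.mem_of_le hb (Multiset.mem_cons_self _ _)), Multiset.map_cons,
        Multiset.sum_cons, smul_add]
  rw [this B' hB', hv, mul_smul]

lemma PP_mul {m q : ℕ} (hq0 : 0 < q) (hm : PP m) (hq : PP q) (hm0 : 0 < m) : PP (m * q) := by
  intro J hJ
  obtain ⟨B, hB, hc⟩ := extract hm J (4 * q - 3) (by
    obtain ⟨q, rfl⟩ := Nat.exists_eq_add_of_lt hq0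
    have : 4 * (0 + q + 1) - 3 = 4 * q + 1 := by omega
    rw [this]
    have e : 4 * (m * (0 + q + 1)) = 4 * q * m + 4 * m := by ring
    rw [e] at hJ
    have e2 : (4 * q + 1) * m = 4 * q * m + m := by ring
    rw [e2]
    omega)
  obtain ⟨S, hS, ⟨t, rfl, ht⟩, hd⟩ := lift_blocks hB q (fun k => k = q) (fun K hK => hq K (by omega))
  exact ⟨S, hS, by rw [ht, mul_comm], hd⟩

lemma PP_all (n : ℕ) (hn : 0 < n) : PP n := by
  induction n using Nat.recOnMul with
  | zero => omega
  | one => exact PP_one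
  | prime p hp => exact PP_prime hp
  | mul a b ha hb =>
    have h1 : 0 < a := Nat.pos_of_mul_pos_right hn
    have h2 : 0 < b := Nat.pos_of_mul_pos_left hn
    exact PP_mul h2 (ha h1) (hb h2) h1

/-- All but two blocks worth of elements can be put into blocks. -/
lemma extract_last {m r : ℕ} (hm : PP m) (hq : QQ m) (J : Multiset (ℤ × ℤ))
    (hJ : J.card = (r + 3) * m) (hd : Dv m J) (hm1 : 0 < m) :
    ∃ B, Blocks m J B ∧ B.card = r + 1 := by
  obtain ⟨B, hB, hc⟩ := extract hm J r (by rw [hJ, add_mul]; omega)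
  obtain ⟨b, hb, h1, h2⟩ := hq (J - B.sum) (by
      rw [Multiset.card_sub hB.1, hB.card, hc, hJ, add_mul]; omega) (Dv_sub hB.1 hB.dv hd)
  exact ⟨b ::ₘ B, hB.cons hb h1 h2, by simp [hc]⟩

lemma Dv_of_mul {m q : ℕ} {J : Multiset (ℤ × ℤ)} (h : Dv (m * q) J) : Dv m J := by
  obtain ⟨w, hw⟩ := h
  exact ⟨q • w, by rw [hw, mul_smul]⟩

lemma QQ_mul {m p : ℕ} (hm0 : 0 < m) (hp : p.Prime) (hm : QQ m) : QQ (m * p) := by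
  intro J hJ hd
  have hp2 := hp.two_le
  obtain ⟨B, hB, hc⟩ := extract_last (r := 3 * p - 3) (PP_all m hm0) hm J
    (by rw [hJ, Nat.sub_add_cancel (by omega)]; ring) (Dv_of_mul hd) hm0
  obtain ⟨S, hS, ⟨t, rfl | rfl, ht⟩, hd'⟩ := lift_blocks hB p (fun k => k = p ∨ k = 2 * p)
    (fun K hK => DD_prime hp K (by omega))
  · exact ⟨S, hS, by rw [ht, mul_comm], hd'⟩
  · refine ⟨J - S, Multiset.sub_le_self _ _, ?_, Dv_sub hS hd' hd⟩
    rw [Multiset.card_sub hS, ht, hJ, show 3 * (m * p) = m * p + 2 * p * m by ring,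
      Nat.add_sub_cancel]

lemma QQ_all (n : ℕ) (hn : 0 < n) : QQ n := by
  induction n using Nat.strong_induction_on with
  | _ n ih =>
    by_cases h1 : n = 1
    · subst h1; exact QQ_one
    · obtain ⟨p, hp, m, rfl⟩ := Nat.exists_prime_and_dvd h1
      have hm : 0 < m := Nat.pos_of_mul_pos_left hn
      rw [mul_comm]
      exact QQ_mul hm hp (ih m (by nlinarith [hp.two_le]) hm)

lemma upper_dvd {k n : ℕ} (hk : 4 ≤ k) (hn : 0 < n) (hkn : k ∣ n) (J : Multiset (ℤ × ℤ))
    (hJ : J.card = 4 * n - k) (hd : Dv n J) : ∃ S ≤ J, S.card = n ∧ Dv n S := by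
  obtain ⟨q, rfl⟩ := hkn
  have hq : 0 < q := Nat.pos_of_mul_pos_left hn
  obtain ⟨B, hB, hc⟩ := extract_last (r := 4 * q - 4) (PP_all k (by omega))
    (QQ_all k (by omega)) J (by
      obtain ⟨q, rfl⟩ := Nat.exists_eq_add_of_lt hq
      rw [hJ, show 4 * (0 + q + 1) - 4 = 4 * q by omega,
        show 4 * (k * (0 + q + 1)) = (4 * q + 3) * k + k by ring, Nat.add_sub_cancel])
    (Dv_of_mul hd) (by omega)
  obtain ⟨S, hS, ⟨t, rfl, ht⟩, hd⟩ := lift_blocks hB q (fun t => t = q)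
    (fun K hK => PP_all q hq K (by omega))
  exact ⟨S, hS, by rw [ht, mul_comm], hd⟩

end MEGZ

namespace MEGZ

lemma upper (n : ℕ) (hn : 0 < n) (J : Multiset (ZMod n × ZMod n)) (hs : J.sum = 0)
    (H : 4 * n - 3 ≤ J.card ∨ ∃ k, 4 ≤ k ∧ k ∣ n ∧ J.card = 4 * n - k) :
    ∃ S ≤ J, S.card = n ∧ S.sum = 0 := by
  have : NeZero n := ⟨hn.ne'⟩
  let g : ZMod n × ZMod n → ℤ × ℤ := fun v => (v.1.val, v.2.val)
  have hg : ∀ v, red n (g v) = v := by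
    intro v
    simp [red, g, AddMonoidHom.prodMap]
  have hmap : (J.map g).map (red n) = J := by
    rw [Multiset.map_map]
    simp [Function.comp_def, hg]
  have key : ∃ S ≤ J.map g, S.card = n ∧ Dv n S := by
    rcases H with h | ⟨k, h1, h2, h3⟩
    · exact PP_all n hn _ (by simpa using h)
    · exact upper_dvd h1 hn h2 _ (by simpa using h3) ((Dv_iff n _).2 (by rw [hmap, hs]))
  obtain ⟨S, h1, h2, h3⟩ := key
  refine ⟨S.map (red n), ?_, by simpa using h2, (Dv_iff n S).1 h3⟩
  have := Multiset.map_le_map (f := red n) h1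
  rwa [hmap] at this

lemma le_add_exists {α : Type*} {S A B : Multiset α} (h : S ≤ A + B) :
    ∃ A' ≤ A, ∃ B' ≤ B, S = A' + B' := by
  classical
  refine ⟨S ⊓ A, inf_le_right, S - A, ?_, ?_⟩
  · rw [tsub_le_iff_left]; exact h
  · rw [add_comm]; exact (Multiset.sub_add_inter S A).symm

lemma solve {n l x : ℕ} (h : Nat.gcd l n ∣ x) : ∃ t : ZMod n, (x : ZMod n) = l * t := by
  obtain ⟨s, rfl⟩ := h
  have := congrArg (Int.cast : ℤ → ZMod n) (Nat.gcd_eq_gcd_ab l n)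
  push_cast at this
  refine ⟨(Nat.gcdA l n : ZMod n) * s, ?_⟩
  push_cast
  rw [this]
  simp
  ring

lemma zero_or {n x : ℕ} (h : n ∣ x) (hx : x ≤ n) : x = 0 ∨ x = n := by
  rcases Nat.eq_zero_or_pos x with h0 | h0
  · exact Or.inl h0
  · exact Or.inr (le_antisymm hx (Nat.le_of_dvd h0 h))

lemma bad (n l a b c d : ℕ) (ha : a < n) (hb : b < n) (hc : c < n) (hd : d < n)
    (hsum : a + b + c + d + l = 4 * n) (h1 : Nat.gcd l n ∣ c + d) (h2 : Nat.gcd l n ∣ b + d) :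
    ∃ J : Multiset (ZMod n × ZMod n), J.card + l = 4 * n ∧ J.sum = 0 ∧
      ¬ ∃ S ≤ J, S.card = n ∧ S.sum = 0 := by
  obtain ⟨t1, ht1⟩ := solve h1
  obtain ⟨t2, ht2⟩ := solve h2
  let J0 : Multiset (ZMod n × ZMod n) := Multiset.replicate a (0, 0) + Multiset.replicate b (0, 1)
    + Multiset.replicate c (1, 0) + Multiset.replicate d (1, 1)
  have hcard : J0.card = a + b + c + d := by simp [J0]
  have hshift : ∀ S : Multiset (ZMod n × ZMod n),
      (S.map (fun v => v + (t1, t2))).sum = S.sum + S.card • (t1, t2) := by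
    intro S
    rw [Multiset.sum_map_add, Multiset.map_id', Multiset.map_const', Multiset.sum_replicate]
  refine ⟨J0.map (fun v => v + (t1, t2)), by rw [Multiset.card_map, hcard, hsum], ?_, ?_⟩
  · rw [hshift, hcard]
    have e : ((a + b + c + d : ℕ) : ZMod n) + l = 0 := by
      have := congrArg (Nat.cast : ℕ → ZMod n) hsum
      push_cast at this ⊢
      rw [this]; simp
    push_cast at ht1 ht2 e
    ext
    · simp [J0]
      linear_combination ht1 + t1 * e
    · simp [J0]
      linear_combination ht2 + t2 * e
  · rintro ⟨S, hS, hSc, hS0⟩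
    obtain ⟨S, hT, rfl⟩ := le_map_exists _ _ _ hS
    rw [Multiset.card_map] at hSc
    rw [hshift, hSc] at hS0
    obtain ⟨A, hA, D, hD, rfl⟩ := le_add_exists hT
    obtain ⟨A, hA2, C, hC, rfl⟩ := le_add_exists hA
    obtain ⟨A, hA3, B, hB, rfl⟩ := le_add_exists hA2
    obtain ⟨a', ha', rfl⟩ := Multiset.le_replicate_iff.1 hA3
    obtain ⟨b', hb', rfl⟩ := Multiset.le_replicate_iff.1 hB
    obtain ⟨c', hc', rfl⟩ := Multiset.le_replicate_iff.1 hC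
    obtain ⟨d', hd', rfl⟩ := Multiset.le_replicate_iff.1 hD
    simp only [Multiset.card_add, Multiset.card_replicate] at hSc
    have e1 := congrArg Prod.fst hS0
    have e2 := congrArg Prod.snd hS0
    simp at e1 e2
    have f1 : n ∣ c' + d' := by
      rw [← ZMod.natCast_eq_zero_iff]; push_cast; exact e1
    have f2 : n ∣ b' + d' := by
      rw [← ZMod.natCast_eq_zero_iff]; push_cast; exact e2
    have g1 := zero_or f1 (by omega)
    have g2 := zero_or f2 (by omega)
    omega

lemma lower (n l : ℕ) (hn : 0 < n) (hl : 4 ≤ l) (hln : ¬ l ∣ n) (hle : l ≤ n + 3) :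
    ∃ J : Multiset (ZMod n × ZMod n), J.card + l = 4 * n ∧ J.sum = 0 ∧
      ¬ ∃ S ≤ J, S.card = n ∧ S.sum = 0 := by
  have hg0 : 0 < Nat.gcd l n := Nat.gcd_pos_of_pos_right _ hn
  have hgn : Nat.gcd l n ∣ n := Nat.gcd_dvd_right _ _
  have hgl : Nat.gcd l n ∣ l := Nat.gcd_dvd_left _ _
  have hgle : Nat.gcd l n ≤ n := Nat.le_of_dvd hn hgn
  by_cases h1 : Nat.gcd l n = 1
  · exact bad n l (n + 3 - l) (n - 1) (n - 1) (n - 1) (by omega) (by omega) (by omega) (by omega)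
      (by omega) (by rw [h1]; exact one_dvd _) (by rw [h1]; exact one_dvd _)
  · have h2 : 2 * Nat.gcd l n ≤ l := by
      obtain ⟨s, hs⟩ := hgl
      have : s ≠ 0 := by rintro rfl; omega
      have : s ≠ 1 := by
        rintro rfl
        rw [mul_one] at hs
        exact hln (hs ▸ hgn)
      have : 2 ≤ s := by omega
      nlinarith
    have h3 : Nat.gcd l n ∣ n + 1 - Nat.gcd l n + (n - 1) := by
      rw [show n + 1 - Nat.gcd l n + (n - 1) = n + n - Nat.gcd l n by omega]
      exact Nat.dvd_sub (dvd_add hgn hgn) dvd_rfl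
    exact bad n l (n - 1 + 2 * Nat.gcd l n - l) (n + 1 - Nat.gcd l n) (n + 1 - Nat.gcd l n) (n - 1)
      (by omega) (by omega) (by omega) (by omega) (by omega) h3 h3

end MEGZ

theorem modified_egz_square (n ℓ : ℕ) (hn : 0 < n)
    (hℓ : IsLeast {m : ℕ | 4 ≤ m ∧ ¬ m ∣ n} ℓ) :
    IsLeast {L : ℕ | ∀ J : Multiset (ZMod n × ZMod n), L ≤ Multiset.card J → J.sum = 0 →
        ∃ S ≤ J, Multiset.card S = n ∧ S.sum = 0}
      (4 * n - ℓ + 1) := by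
  obtain ⟨⟨h4, hnd⟩, hmin⟩ := hℓ
  have hdvd : ∀ k, 4 ≤ k → k < ℓ → k ∣ n := by
    intro k hk hkl
    by_contra h
    have := hmin ⟨hk, h⟩
    omega
  have hle : ℓ ≤ n + 3 := hmin ⟨by omega, fun h => by
    have := Nat.le_of_dvd hn h
    omega⟩
  constructor
  · intro J hJ hs
    refine MEGZ.upper n hn J hs ?_
    by_cases h : 4 * n - 3 ≤ J.card
    · exact Or.inl h
    · exact Or.inr ⟨4 * n - J.card, by omega, hdvd _ (by omega) (by omega), by omega⟩
  · intro L hL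
    by_contra hlt
    obtain ⟨J, h1, h2, h3⟩ := MEGZ.lower n ℓ hn h4 hnd hle
    exact h3 (hL J (by omega) h2)
end
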